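/- arXiv:1309.6966 — 5 statements merged into one kernel-verified Lean document; each statement's English description precedes it below -/
import Mathlib

section
/- Let (R,m,k) be a Noetherian local ring. Define τ_I := ∩_I (I :_R Ī), the intersection taken over all ideals I of R, where Ī is the integral closure of the ideal I. Then: (i) τ_I equals the intersection of (I :_R Ī) over all m-primary ideals I; (ii) τ_I is contained in the intersection of (J :_R J̄) over all m-primary ideals J generated by a system of parameters, with equality if the residue field k is infinite; (iii) τ_M ⊆ τ_I, where τ_M := ∩_M ann_R lic(0,M) with the intersection over all finitely generated R-modules M, and τ_M = τ_I if dim R = 0 or if R is approximately Gorenstein. -/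
/- # Liftable integral closure: core definitions

Free $R$-modules are modeled as `ι →₀ R`, and the symmetric algebra of `ι →₀ R`
is modeled as `MvPolynomial ι R`, with the canonical degree-one embedding sending
the basis vector at `i` to the variable `X i`. -/

noncomputable section

open scoped TensorProduct

namespace LIC

variable (R : Type*) [CommRing R]

/-- The canonical embedding of the free module `ι →₀ R` onto the degree-one part of its
symmetric algebra `MvPolynomial ι R`. -/
def symEmb (ι : Type*) : (ι →₀ R) →ₗ[R] MvPolynomial ι R :=
  Finsupp.linearCombination R MvPolynomial.X

variable {R}

/-- The integral closure `U⁻_F` of a submodule `U` of the free module `F = ι →₀ R`: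
the degree-one part of the integral closure, inside the symmetric algebra of `F`,
of the subalgebra generated by `U`. -/
def freeIC {ι : Type*} (U : Submodule R (ι →₀ R)) : Submodule R (ι →₀ R) where
  carrier := {x | IsIntegral (Algebra.adjoin R (symEmb R ι '' U)) (symEmb R ι x)}
  zero_mem' := by simpa using isIntegral_zero
  add_mem' := by
    intro a b ha hb
    simpa [map_add] using ha.add hb
  smul_mem' := by
    intro c x hx
    have hc : IsIntegral (Algebra.adjoin R (symEmb R ι '' ↑U))
        ((algebraMap R (MvPolynomial ι R)) c) := by
      have : (algebraMap R (MvPolynomial ι R)) c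
          = algebraMap (Algebra.adjoin R (symEmb R ι '' ↑U)) (MvPolynomial ι R)
            ⟨(algebraMap R (MvPolynomial ι R)) c,
              Subalgebra.algebraMap_mem _ c⟩ := rfl
      rw [this]
      exact isIntegral_algebraMap
    have : symEmb R ι (c • x) = (algebraMap R (MvPolynomial ι R)) c * symEmb R ι x := by
      rw [map_smul, Algebra.smul_def]
    simpa [Set.mem_setOf_eq, this] using hc.mul hx
  
/-- The liftable integral closure `lic(L, M)` of a submodule `L ⊆ M`, computed via the
canonical free presentation `M →₀ R ↠ M`.  (By `LIC.lic_indep` this agrees with the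
closure computed from any surjection of a free module onto `M`.) -/
def lic {M : Type*} [AddCommGroup M] [Module R M] (L : Submodule R M) : Submodule R M :=
  Submodule.map (Finsupp.linearCombination R (id : M → M))
    (freeIC (Submodule.comap (Finsupp.linearCombination R (id : M → M)) L))

end LIC

end

namespace LIC

/-- The integral closure `Ī` of an ideal `I`: elements `r` satisfying an equation
`r ^ n + a 1 * r ^ (n-1) + ⋯ + a n = 0` with `a j ∈ I ^ j`. -/
def idealIC {R : Type*} [CommRing R] (I : Ideal R) : Set R :=
  {r | ∃ (n : ℕ) (a : ℕ → R), 0 < n ∧ (∀ j, 1 ≤ j → j ≤ n → a j ∈ I ^ j) ∧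
    r ^ n + ∑ j ∈ Finset.Icc 1 n, a j * r ^ (n - j) = 0}

/-- The colon ideal `(I :_R S)` of an ideal `I` and a set `S ⊆ R`. -/
def colonIdeal {R : Type*} [CommRing R] (I : Ideal R) (S : Set R) : Ideal R where
  carrier := {r | ∀ s ∈ S, r * s ∈ I}
  zero_mem' := by intro s _; simp
  add_mem' := by
    intro a b ha hb s hs
    rw [add_mul]; exact I.add_mem (ha s hs) (hb s hs)
  smul_mem' := by
    intro c r hr s hs
    rw [smul_eq_mul, mul_assoc]; exact I.mul_mem_left c (hr s hs)

/-- The colon submodule `(L :_M J) = {x ∈ M | J • x ⊆ L}`. -/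
def colonSubmodule {R : Type*} [CommRing R] {M : Type*} [AddCommGroup M] [Module R M]
    (L : Submodule R M) (J : Ideal R) : Submodule R M where
  carrier := {x | ∀ j ∈ J, j • x ∈ L}
  zero_mem' := by intro j _; simp
  add_mem' := by
    intro a b ha hb j hj
    rw [smul_add]; exact L.add_mem (ha j hj) (hb j hj)
  smul_mem' := by
    intro c x hx j hj
    rw [smul_comm]; exact L.smul_mem c (hx j hj)

end LIC

namespace LIC

variable (R : Type*) [CommRing R] [IsLocalRing R]

/-- A local ring is approximately Gorenstein if there is a sequence of irreducible
`m`-primary ideals cofinal with the powers of `m`. -/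
def ApproximatelyGorenstein : Prop :=
  ∃ I : ℕ → Ideal R,
    (∀ t, (I t).IsPrimary ∧ (I t).radical = IsLocalRing.maximalIdeal R ∧
      ∀ J K : Ideal R, I t = J ⊓ K → I t = J ∨ I t = K) ∧
    ∀ N : ℕ, ∃ t, I t ≤ (IsLocalRing.maximalIdeal R) ^ N

end LIC

universe u
namespace LICProof

section Gor

lemma length_le_add {R M N P : Type*} [Ring R] [AddCommGroup M] [AddCommGroup N] [AddCommGroup P]
    [Module R M] [Module R N] [Module R P] (f : N →ₗ[R] M) (g : M →ₗ[R] P)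
    (h : LinearMap.ker g ≤ LinearMap.range f) :
    Module.length R M ≤ Module.length R N + Module.length R P := by
  rw [Module.length_eq_add_of_exact (LinearMap.ker g).subtype g.rangeRestrict
    (Submodule.subtype_injective _) g.surjective_rangeRestrict (by
      rw [LinearMap.exact_iff]; simp)]
  gcongr
  · exact (Module.length_le_of_injective (Submodule.inclusion h)
      (Submodule.inclusion_injective h)).trans
      (Module.length_le_of_surjective f.rangeRestrict f.surjective_rangeRestrict)
  · exact Module.length_le_of_injective (LinearMap.range g).subtype (Submodule.subtype_injective _)

variable {A : Type*} [CommRing A] [IsLocalRing A]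

lemma smul_eq_zero_of_simple {S : Type*} [AddCommGroup S] [Module A S] [IsSimpleModule A S]
    {a : A} (ha : a ∈ IsLocalRing.maximalIdeal A) (s : S) : a • s = 0 := by
  by_contra h
  have h1 := IsSimpleModule.span_singleton_eq_top A h
  have h2 : s ∈ Submodule.span A {a • s} := by rw [h1]; trivial
  obtain ⟨b, hb⟩ := Submodule.mem_span_singleton.1 h2
  have h3 : (1 - b * a) • s = 0 := by
    rw [sub_smul, one_smul, mul_smul, hb, sub_self]
  have h4 : IsUnit (1 - b * a) := by
    have := (IsLocalRing.mem_maximalIdeal _).1 (Ideal.mul_mem_left _ b ha)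
    rcases IsLocalRing.isUnit_or_isUnit_of_add_one (a := b * a) (b := 1 - b * a) (by ring) with h | h
    · exact absurd h this
    · exact h
  have : s = 0 := by simpa using (h4.smul_eq_zero).1 h3
  apply h; simp [this]

lemma length_hom_simple (hirr : ∀ J K : Ideal A, J ⊓ K = ⊥ → J = ⊥ ∨ K = ⊥)
    (S : Type*) [AddCommGroup S] [Module A S] [IsSimpleModule A S] :
    Module.length A (S →ₗ[A] A) ≤ 1 := by
  have key : ∀ f g : S →ₗ[A] A, f ≠ 0 → g ∈ Submodule.span A {f} := by
    intro f g hf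
    have : Nontrivial S := IsSimpleModule.nontrivial A S
    obtain ⟨s, hs⟩ := exists_ne (0 : S)
    have htop := IsSimpleModule.span_singleton_eq_top A hs
    have hext : ∀ f g : S →ₗ[A] A, f s = g s → f = g := by
      intro f g h
      refine LinearMap.ext_on (s := {s}) htop ?_
      simpa [Set.EqOn] using h
    have hx : f s ≠ 0 := fun h => hf (hext f 0 (by simpa using h))
    by_cases hy : g s = 0
    · rw [hext g 0 (by simpa using hy)]; exact zero_mem _
    have hne : ¬ (Ideal.span {f s} ⊓ Ideal.span {g s} = ⊥) := by
      intro h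
      rcases hirr _ _ h with h | h
      · exact hx (Ideal.span_singleton_eq_bot.1 h)
      · exact hy (Ideal.span_singleton_eq_bot.1 h)
    obtain ⟨w, ⟨hw1, hw2⟩, hw0⟩ := Submodule.exists_mem_ne_zero_of_ne_bot hne
    obtain ⟨c, hc⟩ := Ideal.mem_span_singleton'.1 hw1
    obtain ⟨d, hd⟩ := Ideal.mem_span_singleton'.1 hw2
    have hdu : IsUnit d := by
      by_contra hdu
      apply hw0
      rw [← hd, ← smul_eq_mul, ← map_smul,
        smul_eq_zero_of_simple ((IsLocalRing.mem_maximalIdeal _).2 hdu), map_zero]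
    obtain ⟨u, rfl⟩ := hdu
    refine Submodule.mem_span_singleton.2 ⟨↑u⁻¹ * c, hext _ _ ?_⟩
    rw [LinearMap.smul_apply, smul_eq_mul, mul_assoc, hc, ← hd, Units.inv_mul_cancel_left]
  by_cases hs : Subsingleton (S →ₗ[A] A)
  · rw [Module.length_eq_zero]; exact zero_le
  · rw [not_subsingleton_iff_nontrivial] at hs
    have : IsSimpleModule A (S →ₗ[A] A) := by
      rw [isSimpleModule_iff_toSpanSingleton_surjective]
      refine ⟨hs, fun f hf g => ?_⟩
      obtain ⟨a, ha⟩ := Submodule.mem_span_singleton.1 (key f g hf)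
      exact ⟨a, by simpa using ha⟩
    rw [Module.length_eq_one]

lemma length_hom_le (hirr : ∀ J K : Ideal A, J ⊓ K = ⊥ → J = ⊥ ∨ K = ⊥)
    (M : Type*) [AddCommGroup M] [Module A M] (h : IsFiniteLength A M) :
    Module.length A (M →ₗ[A] A) ≤ Module.length A M := by
  induction h with
  | of_subsingleton => rw [Module.length_eq_zero]; exact zero_le
  | @of_simple_quotient M _ _ N hs hN ih =>
    have h1 : Module.length A M = Module.length A N + Module.length A (M ⧸ N) :=
      Module.length_eq_add_of_exact N.subtype N.mkQ (Submodule.subtype_injective _)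
        (Submodule.mkQ_surjective _) (by rw [LinearMap.exact_iff]; simp)
    have h2 := length_le_add (LinearMap.lcomp A A N.mkQ) (LinearMap.lcomp A A N.subtype) (by
      intro f hf
      refine ⟨N.liftQ f ?_, ?_⟩
      · intro x hx
        have := LinearMap.congr_fun (LinearMap.mem_ker.1 hf) ⟨x, hx⟩
        simpa using this
      · ext x; simp)
    rw [h1]
    refine h2.trans ?_
    rw [add_comm]
    have h3 := length_hom_simple hirr (M ⧸ N)
    rw [Module.length_eq_one A (M ⧸ N)]
    gcongr

lemma baer_self [IsArtinianRing A] (hirr : ∀ J K : Ideal A, J ⊓ K = ⊥ → J = ⊥ ∨ K = ⊥) :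
    Module.Baer A A := by
  rw [Module.Baer.iff_surjective]
  intro J
  set g := LinearMap.lcomp A A J.subtype
  have hfl : ∀ (M : Type _) [AddCommGroup M] [Module A M] [Module.Finite A M],
      IsFiniteLength A M := fun M _ _ _ => Module.length_ne_top_iff.1 Module.length_ne_top
  have h1 : Module.length A A = Module.length A J + Module.length A (A ⧸ J) :=
      Module.length_eq_add_of_exact J.subtype J.mkQ (Submodule.subtype_injective _)
        (Submodule.mkQ_surjective _) (by rw [LinearMap.exact_iff]; simp)
  have h2 : Module.length A (A →ₗ[A] A) ≤
      Module.length A ((A ⧸ J) →ₗ[A] A) + Module.length A (LinearMap.range g) :=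
    length_le_add (LinearMap.lcomp A A J.mkQ) g.rangeRestrict (by
      rw [LinearMap.ker_rangeRestrict]
      intro f hf
      have hJ : J ≤ LinearMap.ker f := by
        intro x hx
        have := LinearMap.congr_fun (LinearMap.mem_ker.1 hf) ⟨x, hx⟩
        simpa [g] using this
      refine ⟨J.liftQ f hJ, ?_⟩
      ext
      exact Submodule.liftQ_apply J f (h := hJ) 1)
  have h3 : Module.length A (A →ₗ[A] A) = Module.length A A :=
    (LinearMap.ringLmapEquivSelf A A A).length_eq
  have h4 := length_hom_le hirr _ (hfl (A ⧸ J))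
  have h5 := length_hom_le hirr _ (hfl J)
  have h6 : Module.length A (J →ₗ[A] A) = Module.length A (LinearMap.range g) +
      Module.length A ((J →ₗ[A] A) ⧸ LinearMap.range g) :=
      Module.length_eq_add_of_exact (LinearMap.range g).subtype (LinearMap.range g).mkQ
        (Submodule.subtype_injective _)
        (Submodule.mkQ_surjective _) (by rw [LinearMap.exact_iff]; simp)
  have f1 : Module.length A J ≠ ⊤ := Module.length_ne_top_iff.2 (hfl J)
  have f2 : Module.length A (A ⧸ J) ≠ ⊤ := Module.length_ne_top_iff.2 (hfl (A ⧸ J))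
  have h7 : Module.length A ((J →ₗ[A] A) ⧸ LinearMap.range g) = 0 := by
    rw [h3, h1] at h2
    rw [h6] at h5
    generalize Module.length A J = a at *
    generalize Module.length A (A ⧸ J) = b at *
    generalize Module.length A (LinearMap.range g) = c at *
    generalize Module.length A ((J →ₗ[A] A) ⧸ LinearMap.range g) = d at *
    have h8 := h2.trans (add_le_add_left h4 c)
    have hc : c ≠ ⊤ := fun h => f1 (top_le_iff.1 (by simpa [h] using h5))
    have hd : d ≠ ⊤ := fun h => f1 (top_le_iff.1 (by simpa [h] using h5))
    lift a to ℕ using f1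
    lift b to ℕ using f2
    lift c to ℕ using hc
    lift d to ℕ using hd
    norm_cast at *
    omega
  rw [Module.length_eq_zero_iff, Submodule.Quotient.subsingleton_iff] at h7
  exact LinearMap.range_eq_top.1 h7

/-- over a zero-dimensional Gorenstein local ring, maps to the ring separate points -/
lemma exists_dual_artin [IsArtinianRing A] (hirr : ∀ J K : Ideal A, J ⊓ K = ⊥ → J = ⊥ ∨ K = ⊥)
    {M : Type*} [AddCommGroup M] [Module A M] (z : M) (hz : z ≠ 0) :
    ∃ ψ : M →ₗ[A] A, ψ z ≠ 0 := by
  have hb := baer_self hirr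
  -- socle element
  obtain ⟨x, hx0, hx⟩ : ∃ x : A, x ≠ 0 ∧ ∀ a ∈ IsLocalRing.maximalIdeal A, a * x = 0 := by
    obtain ⟨n, hn⟩ := IsArtinianRing.isNilpotent_jacobson_bot (R := A)
    rw [IsLocalRing.jacobson_eq_maximalIdeal _ bot_ne_top] at hn
    classical
    have hex : ∃ n, IsLocalRing.maximalIdeal A ^ n = ⊥ := ⟨n, hn⟩
    have hpos : Nat.find hex ≠ 0 := by
      intro h
      have := Nat.find_spec hex
      rw [h, pow_zero, Ideal.one_eq_top] at this
      exact bot_ne_top this.symm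
    obtain ⟨k, hk⟩ := Nat.exists_eq_succ_of_ne_zero hpos
    have h1 := Nat.find_min hex (m := k) (by omega)
    have h2 := Nat.find_spec hex
    rw [hk, pow_succ'] at h2
    obtain ⟨x, hx, hx0⟩ := Submodule.exists_mem_ne_zero_of_ne_bot h1
    refine ⟨x, hx0, fun a ha => ?_⟩
    have := Ideal.mul_mem_mul ha hx
    rw [h2] at this
    exact this
  let p := Submodule.span A {z}
  -- map A/ann z → A
  let g : A →ₗ[A] A := LinearMap.toSpanSingleton A A x
  let e := LinearMap.quotKerEquivRange (LinearMap.toSpanSingleton A M z)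
  have hle : LinearMap.ker (LinearMap.toSpanSingleton A M z) ≤ LinearMap.ker g := by
    intro a ha
    have : a • z = 0 := by simpa using ha
    have hau : ¬ IsUnit a := fun h => hz (h.smul_eq_zero.1 this)
    simpa [g] using hx a ((IsLocalRing.mem_maximalIdeal _).2 hau)
  obtain ⟨ψ, hψ⟩ := hb.extension_property
    (LinearMap.range (LinearMap.toSpanSingleton A M z)).subtype (Submodule.subtype_injective _)
    ((Submodule.liftQ _ g hle) ∘ₗ e.symm.toLinearMap)
  refine ⟨ψ, ?_⟩
  have h1 := LinearMap.congr_fun hψ (e (Submodule.Quotient.mk 1))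
  have h2 : ψ z = x := by
    have h3 : ((e (Submodule.Quotient.mk 1) : LinearMap.range (LinearMap.toSpanSingleton A M z)) : M)
        = z := by
      simp only [e]
      erw [LinearMap.quotKerEquivRange_apply_mk]
      simp
    rw [LinearMap.comp_apply, Submodule.subtype_apply, h3] at h1
    rw [h1, LinearMap.comp_apply, LinearEquiv.coe_coe, LinearEquiv.symm_apply_apply]
    erw [Submodule.liftQ_apply]
    simp [g]
  rwa [h2]

lemma artin_quot {R : Type*} [CommRing R] [IsLocalRing R] [IsNoetherianRing R]
    (I : Ideal R) (hI : I.radical = IsLocalRing.maximalIdeal R) : IsArtinianRing (R ⧸ I) := by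
    rw [isArtinianRing_iff_isNoetherianRing_krullDimLE_zero]
    refine ⟨inferInstance, ?_⟩
    rw [Ring.krullDimLE_zero_iff]
    intro P hP
    have h1 : (P.comap (Ideal.Quotient.mk I)).IsPrime := inferInstance
    have h2 : I ≤ P.comap (Ideal.Quotient.mk I) := by
      intro x hx
      rw [Ideal.mem_comap, Ideal.Quotient.eq_zero_iff_mem.2 hx]; exact zero_mem _
    have h3 : (P.comap (Ideal.Quotient.mk I)) = IsLocalRing.maximalIdeal R := by
      refine le_antisymm (IsLocalRing.le_maximalIdeal h1.ne_top) ?_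
      rw [← hI]
      exact h1.radical_le_iff.2 h2
    have h4 : P = (IsLocalRing.maximalIdeal R).map (Ideal.Quotient.mk I) := by
      rw [← h3, Ideal.map_comap_of_surjective _ Ideal.Quotient.mk_surjective]
    rcases Ideal.map_eq_top_or_isMaximal_of_surjective (Ideal.Quotient.mk I)
      Ideal.Quotient.mk_surjective (IsLocalRing.maximalIdeal.isMaximal R) with h | h
    · exact absurd (h4.trans h) hP.ne_top
    · rwa [h4]

lemma exists_dual {R : Type*} [CommRing R] [IsLocalRing R] [IsNoetherianRing R]
    (I : Ideal R) (hI : I.radical = IsLocalRing.maximalIdeal R)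
    (hirr : ∀ J K : Ideal R, I = J ⊓ K → I = J ∨ I = K)
    {M : Type*} [AddCommGroup M] [Module R M] (z : M) (hz : z ∉ I • (⊤ : Submodule R M)) :
    ∃ ψ : M →ₗ[R] (R ⧸ I), ψ z ≠ 0 := by
  have hIm : I ≤ IsLocalRing.maximalIdeal R := hI ▸ Ideal.le_radical
  have hne : I ≠ ⊤ := fun h => IsLocalRing.maximalIdeal.isMaximal R |>.ne_top
    (top_le_iff.1 (h ▸ hIm))
  have : Nontrivial (R ⧸ I) := Ideal.Quotient.nontrivial_iff.2 hne
  have : IsLocalRing (R ⧸ I) := IsLocalRing.of_surjective' _ Ideal.Quotient.mk_surjective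
  have : IsArtinianRing (R ⧸ I) := artin_quot I hI
  have hirr' : ∀ J K : Ideal (R ⧸ I), J ⊓ K = ⊥ → J = ⊥ ∨ K = ⊥ := by
    intro J K h
    have h1 : I = J.comap (Ideal.Quotient.mk I) ⊓ K.comap (Ideal.Quotient.mk I) := by
      rw [← Ideal.comap_inf, h, ← RingHom.ker_eq_comap_bot, Ideal.mk_ker]
    have h2 : ∀ J : Ideal (R ⧸ I), I = J.comap (Ideal.Quotient.mk I) → J = ⊥ := by
      intro J hJ
      rw [← Ideal.map_comap_of_surjective _ Ideal.Quotient.mk_surjective J, ← hJ,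
        Ideal.map_quotient_self]
    rcases hirr _ _ h1 with h | h
    · exact Or.inl (h2 _ h)
    · exact Or.inr (h2 _ h)
  obtain ⟨ψ, hψ⟩ := exists_dual_artin hirr'
    (M := M ⧸ I • (⊤ : Submodule R M)) (Submodule.Quotient.mk z)
    (by rwa [Ne, Submodule.Quotient.mk_eq_zero])
  exact ⟨(ψ.restrictScalars R) ∘ₗ (I • (⊤ : Submodule R M)).mkQ, by simpa using hψ⟩

end Gor

end LICProof
namespace LICProof

section Count

/-- multi-indices in `d` variables of degree `n` -/
def mons (d n : ℕ) : Finset (Fin d →₀ ℕ) := Finset.finsuppAntidiag Finset.univ n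

lemma mem_mons {d n : ℕ} {α : Fin d →₀ ℕ} : α ∈ mons d n ↔ ∑ i, α i = n := by
  simp [mons]

lemma mem_mons' {d n : ℕ} {α : Fin d →₀ ℕ} : α ∈ mons d n ↔ α.degree = n := by
  rw [mem_mons, Finsupp.degree_eq_sum]

lemma count_le (d n : ℕ) : ∑ e ∈ Finset.range n, (mons d e).card ≤ n ^ d := by
  rw [← Finset.card_sigma]
  have : n ^ d = (Fintype.piFinset (fun _ : Fin d => Finset.range n)).card := by simp
  rw [this]
  refine Finset.card_le_card_of_injOn (fun x => ⇑x.2) ?_ ?_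
  · rintro ⟨e, α⟩ h
    simp only [Finset.coe_sigma, Set.mem_sigma_iff, Finset.mem_coe, Finset.mem_range,
      mem_mons] at h
    simp only [Finset.mem_coe, Fintype.mem_piFinset, Finset.mem_range]
    intro i
    have := Finset.single_le_sum (f := fun i => α i) (fun _ _ => Nat.zero_le _) (Finset.mem_univ i)
    omega
  · rintro ⟨e, α⟩ h ⟨e', α'⟩ h' heq
    simp only [Finset.coe_sigma, Set.mem_sigma_iff, Finset.mem_coe, Finset.mem_range,
      mem_mons] at h h'
    have h1 : α = α' := DFunLike.coe_injective heq
    subst h1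
    have : e = e' := h.2.symm.trans h'.2
    subst this
    rfl

lemma le_count (d n : ℕ) (hd : 0 < d) :
    n ^ d ≤ ∑ e ∈ Finset.range (d * n), (mons d e).card := by
  rw [← Finset.card_sigma]
  have : n ^ d = (Fintype.piFinset (fun _ : Fin d => Finset.range n)).card := by simp
  rw [this]
  refine Finset.card_le_card_of_injOn
    (fun f => ⟨∑ i, f i, Finsupp.equivFunOnFinite.symm f⟩) ?_ ?_
  · intro f h
    simp only [Finset.mem_coe, Fintype.mem_piFinset, Finset.mem_range] at h
    simp only [Finset.coe_sigma, Set.mem_sigma_iff, Finset.mem_coe, Finset.mem_range,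
      mem_mons]
    refine ⟨?_, by simp⟩
    have : Nonempty (Fin d) := ⟨⟨0, hd⟩⟩
    calc ∑ i, f i < ∑ i : Fin d, n := Finset.sum_lt_sum_of_nonempty Finset.univ_nonempty
          (fun i _ => h i)
      _ = d * n := by simp
  · intro f _ g _ h
    simp only [Sigma.mk.injEq] at h
    exact Finsupp.equivFunOnFinite.symm.injective (eq_of_heq h.2)

variable {R : Type*} [CommRing R]

/-- the value of a monomial -/
noncomputable def mon {d : ℕ} (s : Fin d → R) (α : Fin d →₀ ℕ) : R :=
  MvPolynomial.eval s (MvPolynomial.monomial α 1)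

lemma span_pow_eq {d : ℕ} (s : Fin d → R) (n : ℕ) :
    Ideal.span (Set.range s) ^ n = Ideal.span (mon s '' (mons d n : Set (Fin d →₀ ℕ))) := by
  apply le_antisymm
  · intro x hx
    obtain ⟨p, hp, rfl⟩ := (Ideal.mem_span_pow_iff_exists_isHomogeneous s x).1 hx
    rw [p.as_sum, map_sum]
    refine Ideal.sum_mem _ fun α hα => ?_
    have : MvPolynomial.monomial α (p.coeff α) =
        MvPolynomial.C (p.coeff α) * MvPolynomial.monomial α 1 := by
      rw [MvPolynomial.C_mul_monomial, mul_one]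
    rw [this, map_mul]
    refine Ideal.mul_mem_left _ _ (Ideal.subset_span ⟨α, ?_, rfl⟩)
    rw [Finset.mem_coe, mem_mons', Finsupp.degree_eq_weight_one]
    exact hp (MvPolynomial.mem_support_iff.1 hα)
  · rw [Ideal.span_le]
    rintro _ ⟨α, hα, rfl⟩
    refine (Ideal.mem_span_pow_iff_exists_isHomogeneous s _).2 ⟨_, ?_, rfl⟩
    exact MvPolynomial.isHomogeneous_monomial _ (mem_mons'.1 hα)

lemma mon_mem {d : ℕ} (s : Fin d → R) {n : ℕ} {α : Fin d →₀ ℕ} (h : α ∈ mons d n) :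
    mon s α ∈ Ideal.span (Set.range s) ^ n := by
  rw [span_pow_eq]; exact Ideal.subset_span ⟨α, h, rfl⟩

/-- colength -/
noncomputable def L (J : Ideal R) : ℕ∞ := Module.length R (R ⧸ J)

lemma L_anti {J K : Ideal R} (h : J ≤ K) : L K ≤ L J :=
  Module.length_le_of_surjective (Submodule.mapQ J K LinearMap.id (by simpa using h))
    (by
      intro x
      obtain ⟨y, rfl⟩ := Submodule.Quotient.mk_surjective _ x
      exact ⟨Submodule.Quotient.mk y, by simp⟩)

lemma L_add_one {J : Ideal R} {x : R} (hx : x ∉ J) : L (J ⊔ Ideal.span {x}) + 1 ≤ L J := by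
  have hle : J ≤ J ⊔ Ideal.span {x} := le_sup_left
  let g : (R ⧸ J) →ₗ[R] (R ⧸ (J ⊔ Ideal.span {x})) :=
    Submodule.mapQ J _ LinearMap.id (by simp)
  have hg : Function.Surjective g := by
      intro x
      obtain ⟨y, rfl⟩ := Submodule.Quotient.mk_surjective _ x
      exact ⟨Submodule.Quotient.mk y, by simp [g]⟩
  have h1 : Module.length R (R ⧸ J) = Module.length R (LinearMap.ker g) +
      Module.length R (R ⧸ (J ⊔ Ideal.span {x})) :=
    Module.length_eq_add_of_exact (LinearMap.ker g).subtype g (Submodule.subtype_injective _)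
      hg (by rw [LinearMap.exact_iff]; simp)
  have h2 : Nontrivial (LinearMap.ker g) := by
    refine ⟨⟨⟨Submodule.Quotient.mk x, ?_⟩, 0, ?_⟩⟩
    · simp only [LinearMap.mem_ker, g, Submodule.mapQ_apply, LinearMap.id_apply]
      rw [Submodule.Quotient.mk_eq_zero]
      exact Ideal.mem_sup_right (Ideal.mem_span_singleton_self x)
    · intro h
      apply hx
      have := congrArg Subtype.val h
      exact (Submodule.Quotient.mk_eq_zero J).1 this
  rw [L, L, h1, add_comm]
  gcongr
  exact Order.one_le_iff_pos.2 Module.length_pos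

lemma L_le_add {J q : Ideal R} {x : R} (hx : ∀ a ∈ q, a * x ∈ J) :
    L J ≤ L (J ⊔ Ideal.span {x}) + L q := by
  have hle : J ≤ J ⊔ Ideal.span {x} := le_sup_left
  let g : (R ⧸ J) →ₗ[R] (R ⧸ (J ⊔ Ideal.span {x})) :=
    Submodule.mapQ J _ LinearMap.id (by simp)
  let f : (R ⧸ q) →ₗ[R] (R ⧸ J) :=
    Submodule.mapQ q J (LinearMap.toSpanSingleton R R x) (fun a ha => by simpa using hx a ha)
  have := length_le_add f g (by
    intro y hy
    obtain ⟨y, rfl⟩ := Submodule.Quotient.mk_surjective _ y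
    simp only [LinearMap.mem_ker, g, Submodule.mapQ_apply, LinearMap.id_apply] at hy
    rw [Submodule.Quotient.mk_eq_zero] at hy
    obtain ⟨j, hj, w, hw, rfl⟩ := Submodule.mem_sup.1 hy
    obtain ⟨a, rfl⟩ := Ideal.mem_span_singleton'.1 hw
    refine ⟨Submodule.Quotient.mk a, ?_⟩
    simp only [f, Submodule.mapQ_apply, LinearMap.toSpanSingleton_apply]
    rw [Submodule.Quotient.eq]
    simpa using neg_mem hj)
  rw [add_comm]
  exact this

lemma L_le_finset {ι : Type*} (T : Finset ι) (x : ι → R) (J q : Ideal R)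
    (hx : ∀ t ∈ T, ∀ a ∈ q, a * x t ∈ J) :
    L J ≤ L (J ⊔ Ideal.span (x '' (T : Set ι))) + T.card * L q := by
  classical
  induction T using Finset.induction_on with
  | empty => simp
  | insert t T ht ih =>
    have h1 := ih (fun s hs => hx s (Finset.mem_insert_of_mem hs))
    have h2 := L_le_add (J := J ⊔ Ideal.span (x '' (T : Set ι))) (q := q) (x := x t)
      (fun a ha => Ideal.mem_sup_left (hx t (Finset.mem_insert_self _ _) a ha))
    have h3 : J ⊔ Ideal.span (x '' ((insert t T : Finset ι) : Set ι)) =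
        J ⊔ Ideal.span (x '' (T : Set ι)) ⊔ Ideal.span {x t} := by
      rw [Finset.coe_insert, Set.image_insert_eq, Ideal.span_insert, sup_comm (Ideal.span {x t}),
        sup_assoc]
    rw [h3, Finset.card_insert_of_notMem ht]
    refine h1.trans ((add_le_add_left h2 _).trans ?_)
    push_cast
    rw [add_mul, one_mul, add_assoc, add_comm (L q)]

lemma finset_le_L {ι : Type*} (T : Finset ι) (x : ι → R) (J : Ideal R)
    (hx : ∀ t ∈ T, x t ∉ J ⊔ Ideal.span (x '' ((T : Set ι) \ {t}))) :
    L (J ⊔ Ideal.span (x '' (T : Set ι))) + T.card ≤ L J := by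
  classical
  induction T using Finset.induction_on with
  | empty => simp
  | insert t T ht ih =>
    have h1 := ih (fun s hs h => hx s (Finset.mem_insert_of_mem hs) (by
      refine (sup_le_sup_left (Ideal.span_mono (Set.image_mono ?_)) J :) h
      exact Set.sdiff_subset_sdiff_left (by simp)))
    have h2 := L_add_one (J := J ⊔ Ideal.span (x '' (T : Set ι))) (x := x t)
      (fun h => hx t (Finset.mem_insert_self _ _) (by
        refine (sup_le_sup_left (Ideal.span_mono (Set.image_mono ?_)) J :) h
        intro s hs
        refine ⟨by simp [Finset.mem_coe.1 hs], ?_⟩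
        rintro rfl
        exact ht hs))
    have h3 : J ⊔ Ideal.span (x '' ((insert t T : Finset ι) : Set ι)) =
        J ⊔ Ideal.span (x '' (T : Set ι)) ⊔ Ideal.span {x t} := by
      rw [Finset.coe_insert, Set.image_insert_eq, Ideal.span_insert, sup_comm (Ideal.span {x t}),
        sup_assoc]
    rw [h3, Finset.card_insert_of_notMem ht]
    refine le_trans ?_ h1
    push_cast
    rw [add_comm (T.card : ℕ∞), ← add_assoc]
    exact add_le_add_left h2 _

lemma L_pow_le {d : ℕ} (s : Fin d → R) (n : ℕ) :
    L (Ideal.span (Set.range s) ^ n) ≤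
      ((∑ e ∈ Finset.range n, (mons d e).card : ℕ) : ℕ∞) * L (Ideal.span (Set.range s)) := by
  induction n with
  | zero =>
    simp only [pow_zero, Ideal.one_eq_top, Finset.range_zero, Finset.sum_empty, Nat.cast_zero,
      zero_mul, nonpos_iff_eq_zero, L, Module.length_eq_zero_iff]
    exact Submodule.Quotient.subsingleton_iff.2 rfl
  | succ n ih =>
    have h1 := L_le_finset (mons d n) (mon s) (Ideal.span (Set.range s) ^ (n + 1))
      (Ideal.span (Set.range s)) (fun α hα a ha => by
        rw [pow_succ']; exact Ideal.mul_mem_mul ha (mon_mem s hα))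
    rw [← span_pow_eq, sup_eq_right.2 (Ideal.pow_le_pow_right (Nat.le_succ n))] at h1
    refine h1.trans ((add_le_add_left ih _).trans ?_)
    rw [Finset.sum_range_succ]
    push_cast
    rw [add_mul]

lemma le_L_pow [IsLocalRing R] {d : ℕ} (s : Fin d → R)
    (hs : Ideal.span (Set.range s) ≤ IsLocalRing.maximalIdeal R)
    (h : ∀ (e : ℕ) (P : MvPolynomial (Fin d) R), P.IsHomogeneous e →
      MvPolynomial.eval s P ∈ IsLocalRing.maximalIdeal R * Ideal.span (Set.range s) ^ e →
      ∀ α, P.coeff α ∈ IsLocalRing.maximalIdeal R) (n : ℕ) :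
    ((∑ e ∈ Finset.range n, (mons d e).card : ℕ) : ℕ∞) ≤ L (Ideal.span (Set.range s) ^ n) := by
  classical
  induction n with
  | zero => simp
  | succ n ih =>
    have h1 := finset_le_L (mons d n) (mon s)
      (IsLocalRing.maximalIdeal R * Ideal.span (Set.range s) ^ n) (by
      intro α hα hmem
      obtain ⟨y, hy, w, hw, hyw⟩ := Submodule.mem_sup.1 hmem
      obtain ⟨c, hcT, hcw⟩ := (Finsupp.mem_span_image_iff_linearCombination R).1 hw
      let P : MvPolynomial (Fin d) R := MvPolynomial.monomial α 1 -
        ∑ β ∈ c.support, MvPolynomial.C (c β) * MvPolynomial.monomial β 1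
      have hcβ : ∀ β ∈ c.support, β ∈ mons d n ∧ β ≠ α := by
        intro β hβ
        have := hcT hβ
        exact ⟨this.1, this.2⟩
      have hP : P.IsHomogeneous n := by
        refine MvPolynomial.IsHomogeneous.sub
          (MvPolynomial.isHomogeneous_monomial _ (mem_mons'.1 hα)) ?_
        refine MvPolynomial.IsHomogeneous.sum _ _ _ fun β hβ => ?_
        rw [MvPolynomial.C_mul_monomial]
        exact MvPolynomial.isHomogeneous_monomial _ (mem_mons'.1 (hcβ β hβ).1)
      have hev : MvPolynomial.eval s P = y := by
        have h5 : MvPolynomial.eval s P = mon s α - w := by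
          rw [← hcw, Finsupp.linearCombination_apply, Finsupp.sum]
          simp only [P, map_sub, map_sum, map_mul, MvPolynomial.eval_C, mon, smul_eq_mul]
        rw [h5, ← hyw]; ring
      have hco : P.coeff α = 1 := by
        simp only [P, MvPolynomial.coeff_sub, MvPolynomial.coeff_sum, MvPolynomial.coeff_C_mul,
          MvPolynomial.coeff_monomial, if_true]
        rw [Finset.sum_eq_zero, sub_zero]
        intro β hβ
        rw [if_neg (hcβ β hβ).2, mul_zero]
      have h6 := h n P hP (by rw [hev]; exact hy) α
      rw [hco] at h6
      exact (IsLocalRing.maximalIdeal.isMaximal R).ne_top ((Ideal.eq_top_iff_one _).2 h6))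
    rw [← span_pow_eq, sup_eq_right.2 Ideal.mul_le_right] at h1
    have h2 : L (IsLocalRing.maximalIdeal R * Ideal.span (Set.range s) ^ n) ≤
        L (Ideal.span (Set.range s) ^ (n + 1)) :=
      L_anti (by rw [pow_succ']; exact Ideal.mul_mono_left hs)
    rw [Finset.sum_range_succ]
    push_cast
    push_cast at ih
    exact (add_le_add_left ih _).trans (h1.trans h2)

/-- if `I` has more than `dim R` generators, the fiber cone has a relation -/
lemma exists_relation [IsLocalRing R] [IsNoetherianRing R] {d m : ℕ} (hd : (d : WithBot ℕ∞) = ringKrullDim R)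
    (hdm : d < m) (a : Fin m → R)
    (ha : (Ideal.span (Set.range a)).radical = IsLocalRing.maximalIdeal R) :
    ∃ (e : ℕ) (P : MvPolynomial (Fin m) R), P.IsHomogeneous e ∧
      MvPolynomial.eval a P ∈ IsLocalRing.maximalIdeal R * Ideal.span (Set.range a) ^ e ∧
      ∃ α, P.coeff α ∉ IsLocalRing.maximalIdeal R := by
  by_contra hcon
  have hcon' : ∀ (e : ℕ) (P : MvPolynomial (Fin m) R), P.IsHomogeneous e →
      MvPolynomial.eval a P ∈ IsLocalRing.maximalIdeal R * Ideal.span (Set.range a) ^ e →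
      ∀ α, P.coeff α ∈ IsLocalRing.maximalIdeal R := by
    intro e P h1 h2 α
    by_contra h3
    exact hcon ⟨e, P, h1, h2, α, h3⟩
  set I := Ideal.span (Set.range a) with hI
  have hIm : I ≤ IsLocalRing.maximalIdeal R := ha ▸ Ideal.le_radical
  -- parameters
  obtain ⟨S, hS, hcard⟩ :=
    (IsLocalRing.maximalIdeal R).exists_finset_card_eq_height_of_isNoetherianRing
  have hSd : S.card = d := by
    rw [← IsLocalRing.maximalIdeal_height_eq_ringKrullDim, ← hcard] at hd
    exact_mod_cast hd.symm
  let s : Fin d → R := fun i => (S.equivFinOfCardEq hSd).symm i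
  have hs : Set.range s = (S : Set R) := by
    ext x
    constructor
    · rintro ⟨i, rfl⟩; exact ((S.equivFinOfCardEq hSd).symm i).2
    · intro hx; exact ⟨S.equivFinOfCardEq hSd ⟨x, hx⟩, by simp [s]⟩
  have hq : (Ideal.span (Set.range s)).radical = IsLocalRing.maximalIdeal R := by
    rw [hs]
    apply le_antisymm
    · exact (Ideal.IsPrime.radical_le_iff inferInstance).2 hS.1.2
    · rw [Ideal.radical_eq_sInf]
      refine le_sInf ?_
      rintro P ⟨hP1, hP2⟩
      exact hS.2 ⟨hP2, hP1⟩ (IsLocalRing.le_maximalIdeal hP2.ne_top)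
  have hfin : L (Ideal.span (Set.range s)) ≠ ⊤ := by
    have := artin_quot _ hq
    rw [L, Module.length_eq_of_surjective (S := R) (R := R ⧸ Ideal.span (Set.range s))
      Ideal.Quotient.mk_surjective]
    exact Module.length_ne_top
  obtain ⟨t, ht⟩ : ∃ t, Ideal.span (Set.range s) ^ t ≤ I := by
    refine Ideal.exists_pow_le_of_le_radical_of_fg ?_ (IsNoetherian.noetherian _)
    rw [ha, ← hq]; exact Ideal.le_radical
  obtain ⟨c, hc⟩ := ENat.ne_top_iff_exists.1 hfin
  have key : ∀ n : ℕ, n ^ m ≤ (t * (m * n)) ^ d * c := by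
    intro n
    have h1 := le_count m n (by omega)
    have h2 := le_L_pow a hIm hcon' (m * n)
    have h3 : L (I ^ (m * n)) ≤ L (Ideal.span (Set.range s) ^ (t * (m * n))) :=
      L_anti (by rw [pow_mul]; exact Ideal.pow_right_mono ht _)
    have h4 := L_pow_le s (t * (m * n))
    have h5 := count_le d (t * (m * n))
    rw [← hc] at h4
    have h6 := (h2.trans h3).trans h4
    norm_cast at h6
    exact (h1.trans h6).trans (Nat.mul_le_mul_right _ h5)
  have h7 := key ((t * m) ^ d * c + 1)
  set n := (t * m) ^ d * c + 1 with hn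
  have h8 : n ^ (d + 1) ≤ n ^ m := Nat.pow_le_pow_right (by omega) hdm
  have h9 : (t * (m * n)) ^ d * c = n ^ d * ((t * m) ^ d * c) := by
    rw [← mul_assoc, mul_pow]; ring
  rw [h9] at h7
  have h10 : n ^ d * n ≤ n ^ d * ((t * m) ^ d * c) := by
    rw [← pow_succ]; exact h8.trans h7
  have h11 : 0 < n ^ d := Nat.pow_pos (by omega)
  have := Nat.le_of_mul_le_mul_left h10 h11
  omega

end Count

end LICProof
namespace LICProof

open LIC

section Red

variable {R : Type*} [CommRing R]

lemma mon_sub_mem {d : ℕ} (a b : Fin d → R) (I J : Ideal R) (hab : ∀ j, a j - b j ∈ J)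
    (ha : ∀ j, a j ∈ I) (hb : ∀ j, b j ∈ I) (n : ℕ) :
    ∀ α : Fin d →₀ ℕ, α.degree = n → mon a α - mon b α ∈ J * I ^ (n - 1) := by
  induction n with
  | zero =>
    intro α hα
    rw [Finsupp.degree_eq_zero_iff] at hα
    subst hα
    simp [mon]
  | succ n ih =>
    intro α hα
    obtain ⟨i, hi⟩ : ∃ i, α i ≠ 0 := by
      by_contra h
      push Not at h
      have : α = 0 := Finsupp.ext h
      subst this
      simp at hα
    obtain ⟨β, rfl⟩ : ∃ β, α = β + Finsupp.single i 1 := by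
      refine ⟨α - Finsupp.single i 1, (tsub_add_cancel_of_le ?_).symm⟩
      rw [Finsupp.single_le_iff]; omega
    have hβ : β.degree = n := by
      rw [map_add, Finsupp.degree_single] at hα; omega
    have hm : ∀ s : Fin d → R, mon s (β + Finsupp.single i 1) = mon s β * s i := by
      intro s
      simp only [mon]
      rw [show (MvPolynomial.monomial (β + Finsupp.single i 1) (1 : R)) =
        MvPolynomial.monomial β 1 * MvPolynomial.X i by
          rw [MvPolynomial.X, MvPolynomial.monomial_mul, one_mul], map_mul, MvPolynomial.eval_X]
    have hamem : mon a β ∈ I ^ n := by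
      refine Ideal.pow_right_mono ?_ n (mon_mem a (mem_mons'.2 hβ))
      rw [Ideal.span_le]; rintro _ ⟨j, rfl⟩; exact ha j
    rw [hm, hm, show mon a β * a i - mon b β * b i =
      (a i - b i) * mon a β + (mon a β - mon b β) * b i by ring, Nat.add_sub_cancel]
    refine Ideal.add_mem _ (Ideal.mul_mem_mul (hab i) hamem) ?_
    have h1 := ih β hβ
    rcases Nat.eq_zero_or_pos n with h0 | h0
    · subst h0
      rw [Finsupp.degree_eq_zero_iff] at hβ
      subst hβ
      simp [mon]
    · have h2 := Ideal.mul_mem_mul h1 (hb i)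
      rwa [mul_assoc, ← pow_succ, Nat.sub_add_cancel h0] at h2

lemma eval_eq_sum_mon {d : ℕ} (a : Fin d → R) (P : MvPolynomial (Fin d) R) :
    MvPolynomial.eval a P = ∑ α ∈ P.support, P.coeff α * mon a α := by
  conv_lhs => rw [P.as_sum, map_sum]
  refine Finset.sum_congr rfl fun α _ => ?_
  rw [show MvPolynomial.monomial α (P.coeff α) =
        MvPolynomial.C (P.coeff α) * MvPolynomial.monomial α 1 by
      rw [MvPolynomial.C_mul_monomial, mul_one], map_mul, MvPolynomial.eval_C, mon]

lemma degree_of_mem {d e : ℕ} {P : MvPolynomial (Fin d) R} (hP : P.IsHomogeneous e)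
    {α : Fin d →₀ ℕ} (hα : α ∈ P.support) : α.degree = e := by
  rw [Finsupp.degree_eq_weight_one]
  exact hP (MvPolynomial.mem_support_iff.1 hα)

lemma eval_sub_mem {d e : ℕ} (a b : Fin d → R) (I J : Ideal R) (hab : ∀ j, a j - b j ∈ J)
    (ha : ∀ j, a j ∈ I) (hb : ∀ j, b j ∈ I) (P : MvPolynomial (Fin d) R) (hP : P.IsHomogeneous e) :
    MvPolynomial.eval a P - MvPolynomial.eval b P ∈ J * I ^ (e - 1) := by
  rw [eval_eq_sum_mon, eval_eq_sum_mon, ← Finset.sum_sub_distrib]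
  refine Ideal.sum_mem _ fun α hα => ?_
  rw [← mul_sub]
  exact Ideal.mul_mem_left _ _ (mon_sub_mem a b I J hab ha hb e α (degree_of_mem hP hα))

lemma eval_scale {d e : ℕ} (c : Fin d → R) (t : R) (P : MvPolynomial (Fin d) R)
    (hP : P.IsHomogeneous e) :
    MvPolynomial.eval (fun j => c j * t) P = MvPolynomial.eval c P * t ^ e := by
  rw [eval_eq_sum_mon, eval_eq_sum_mon, Finset.sum_mul]
  refine Finset.sum_congr rfl fun α hα => ?_
  rw [mul_assoc]
  congr 1
  rw [← degree_of_mem hP hα]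
  simp only [mon, MvPolynomial.eval_monomial, one_mul, mul_pow, Finsupp.prod_mul]
  congr 1
  rw [Finsupp.prod, Finset.prod_pow_eq_pow_sum]; rfl

lemma pow_le_aux {I J : Ideal R} {t : R} (hJ : J ≤ I) (ht : t ∈ I) (h : I ≤ J ⊔ Ideal.span {t})
    (n : ℕ) : I ^ (n + 1) ≤ J * I ^ n ⊔ Ideal.span {t ^ (n + 1)} := by
  induction n with
  | zero => simpa using h
  | succ n ih =>
    calc I ^ (n + 2) = I ^ (n + 1) * I := pow_succ _ _
      _ ≤ (J * I ^ n ⊔ Ideal.span {t ^ (n + 1)}) * I := Ideal.mul_mono_left ih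
      _ = J * I ^ (n + 1) ⊔ Ideal.span {t ^ (n + 1)} * I := by
        rw [Ideal.sup_mul, mul_assoc, ← pow_succ]
      _ ≤ J * I ^ (n + 1) ⊔ Ideal.span {t ^ (n + 1)} * (J ⊔ Ideal.span {t}) :=
        sup_le_sup_left (Ideal.mul_mono_right h) _
      _ ≤ J * I ^ (n + 1) ⊔ Ideal.span {t ^ (n + 1 + 1)} := by
        rw [Ideal.mul_sup, Ideal.span_singleton_mul_span_singleton, ← pow_succ]
        refine sup_le le_sup_left (sup_le (le_sup_of_le_left ?_) le_sup_right)
        rw [mul_comm]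
        refine Ideal.mul_mono_right ?_
        rw [Ideal.span_singleton_le_iff_mem]
        exact Ideal.pow_mem_pow ht _

/-- one step of the construction of a minimal reduction -/
lemma red_step [IsLocalRing R] [IsNoetherianRing R] [Infinite (IsLocalRing.ResidueField R)]
    {d m : ℕ} (hd : (d : WithBot ℕ∞) = ringKrullDim R)
    (hdm : d < m + 1) (a : Fin (m + 1) → R)
    (ha : (Ideal.span (Set.range a)).radical = IsLocalRing.maximalIdeal R) :
    ∃ (a' : Fin m → R) (n : ℕ), Ideal.span (Set.range a') ≤ Ideal.span (Set.range a) ∧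
      Ideal.span (Set.range a) ^ (n + 1) ≤
        Ideal.span (Set.range a') * Ideal.span (Set.range a) ^ n := by
  obtain ⟨e, P, hP, hPa, α, hα⟩ := exists_relation hd hdm a ha
  set I := Ideal.span (Set.range a) with hI
  have haI : ∀ j, a j ∈ I := fun j => Ideal.subset_span ⟨j, rfl⟩
  obtain ⟨n, rfl⟩ : ∃ n, e = n + 1 := by
    rcases e with _ | n
    · exfalso
      have h1 : ∀ β, P.coeff β ≠ 0 → β = 0 := by
        intro β hβ
        have := degree_of_mem hP (MvPolynomial.mem_support_iff.2 hβ)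
        exact (Finsupp.degree_eq_zero_iff _).1 this
      have hα0 : α = 0 := h1 α (fun h => hα (h ▸ zero_mem _))
      subst hα0
      apply hα
      have h2 : MvPolynomial.eval a P = P.coeff 0 := by
        have : P = MvPolynomial.C (P.coeff 0) := by
          ext β
          rw [MvPolynomial.coeff_C]
          split_ifs with h
          · rw [h]
          · by_contra h'
            exact h (h1 β h').symm
        conv_lhs => rw [this]
        simp
      rw [h2] at hPa
      simpa using hPa
    · exact ⟨n, rfl⟩
  -- generic point
  have hne : MvPolynomial.map (IsLocalRing.residue R) P ≠ 0 := by
    intro h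
    apply hα
    rw [← IsLocalRing.residue_eq_zero_iff, ← MvPolynomial.coeff_map, h, MvPolynomial.coeff_zero]
  obtain ⟨cb, hcb⟩ : ∃ cb, MvPolynomial.eval cb (MvPolynomial.map (IsLocalRing.residue R) P) ≠ 0 := by
    by_contra h
    push Not at h
    exact hne (MvPolynomial.funext (by simpa using h))
  choose c hc using fun j => IsLocalRing.residue_surjective (cb j)
  have hcP : IsUnit (MvPolynomial.eval c P) := by
    rw [← IsLocalRing.residue_ne_zero_iff_isUnit]
    intro h
    apply hcb
    have hcc : cb = fun j => IsLocalRing.residue R (c j) := funext fun j => (hc j).symm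
    rw [hcc, ← h, MvPolynomial.map_eval]
    rfl
  obtain ⟨i, hi⟩ : ∃ i, IsUnit (c i) := by
    by_contra h
    push Not at h
    have h1 : MvPolynomial.eval c P ∈ Ideal.span (Set.range c) ^ (n + 1) :=
      (Ideal.mem_span_pow_iff_exists_isHomogeneous c _).2 ⟨P, hP, rfl⟩
    have h2 : Ideal.span (Set.range c) ≤ IsLocalRing.maximalIdeal R := by
      rw [Ideal.span_le]; rintro _ ⟨j, rfl⟩; exact (IsLocalRing.mem_maximalIdeal _).2 (h j)
    exact (IsLocalRing.mem_maximalIdeal _).1 (h2 (Ideal.pow_le_self (by omega) h1)) hcP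
  obtain ⟨u, hu⟩ := hi
  let t := ↑u⁻¹ * a i
  have htI : t ∈ I := Ideal.mul_mem_left _ _ (haI i)
  have hait : a i = c i * t := by
    rw [← hu]; simp [t]
  let a' : Fin m → R := fun j => a (i.succAbove j) - c (i.succAbove j) * t
  set J := Ideal.span (Set.range a') with hJ
  have hJI : J ≤ I := by
    rw [hJ, Ideal.span_le]
    rintro _ ⟨j, rfl⟩
    exact sub_mem (haI _) (Ideal.mul_mem_left _ _ htI)
  have hab : ∀ j, a j - c j * t ∈ J := by
    intro j
    rcases Fin.eq_self_or_eq_succAbove i j with h | ⟨k, h⟩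
    · rw [h, hait, sub_self]; exact zero_mem _
    · rw [h]; exact Ideal.subset_span ⟨k, rfl⟩
  have hIJ : I ≤ J ⊔ Ideal.span {t} := by
    rw [hI, Ideal.span_le]
    rintro _ ⟨j, rfl⟩
    rw [show a j = (a j - c j * t) + c j * t by ring]
    exact Ideal.add_mem _ (Ideal.mem_sup_left (hab j))
      (Ideal.mem_sup_right (Ideal.mul_mem_left _ _ (Ideal.mem_span_singleton_self t)))
  refine ⟨a', n, hJI, ?_⟩
  have h1 := eval_sub_mem a (fun j => c j * t) I J hab haI
    (fun j => Ideal.mul_mem_left _ _ htI) P hP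
  rw [eval_scale c t P hP, Nat.add_sub_cancel] at h1
  have h2 : t ^ (n + 1) ∈ J * I ^ n ⊔ IsLocalRing.maximalIdeal R * I ^ (n + 1) := by
    have h3 : MvPolynomial.eval c P * t ^ (n + 1) ∈
        J * I ^ n ⊔ IsLocalRing.maximalIdeal R * I ^ (n + 1) := by
      rw [show MvPolynomial.eval c P * t ^ (n + 1) = MvPolynomial.eval a P -
        (MvPolynomial.eval a P - MvPolynomial.eval c P * t ^ (n + 1)) by ring]
      exact sub_mem (Ideal.mem_sup_right hPa) (Ideal.mem_sup_left h1)
    obtain ⟨v, hv⟩ := hcP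
    have h4 := Ideal.mul_mem_left _ (↑v⁻¹ : R) h3
    rwa [← hv, Units.inv_mul_cancel_left] at h4
  refine Submodule.le_of_le_smul_of_le_jacobson_bot (I := IsLocalRing.maximalIdeal R)
    (IsNoetherian.noetherian _) (IsLocalRing.maximalIdeal_le_jacobson _) ?_
  refine (pow_le_aux hJI htI hIJ n).trans (sup_le le_sup_left ?_)
  rw [Ideal.span_singleton_le_iff_mem]
  exact h2

/-! ### integral closure of ideals -/

lemma idealIC_mono {I J : Ideal R} (h : I ≤ J) : idealIC I ⊆ idealIC J := by
  rintro x ⟨n, a, hn, ha, hx⟩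
  exact ⟨n, a, hn, fun j h1 h2 => Ideal.pow_right_mono h j (ha j h1 h2), hx⟩

lemma mem_idealIC_of_sum {I : Ideal R} {x : R} (D : ℕ) (hD : 0 < D) (b : ℕ → R)
    (hb : ∀ k < D, b k ∈ I ^ (D - k))
    (hx : x ^ D + ∑ k ∈ Finset.range D, b k * x ^ k = 0) : x ∈ idealIC I := by
  refine ⟨D, fun j => b (D - j), hD, ?_, ?_⟩
  · intro j h1 h2
    have := hb (D - j) (by omega)
    rwa [show D - (D - j) = j by omega] at this
  · rw [← hx]
    congr 1
    refine Finset.sum_nbij' (fun j => D - j) (fun k => D - k) ?_ ?_ ?_ ?_ ?_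
    · intro j hj; simp at hj ⊢; omega
    · intro j hj; simp at hj ⊢; omega
    · intro j hj; simp at hj ⊢; omega
    · intro j hj; simp at hj ⊢; omega
    · intro j hj; rfl

lemma exists_red_of_mem {I : Ideal R} {x : R} (hx : x ∈ idealIC I) :
    ∃ n, (I ⊔ Ideal.span {x}) ^ (n + 1) ≤ I * (I ⊔ Ideal.span {x}) ^ n := by
  obtain ⟨n, a, hn, ha, hx⟩ := hx
  obtain ⟨n, rfl⟩ : ∃ k, n = k + 1 := ⟨n - 1, by omega⟩
  refine ⟨n, ?_⟩
  set K := I ⊔ Ideal.span {x} with hK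
  have hIK : I ≤ K := le_sup_left
  have hxK : x ∈ K := Ideal.mem_sup_right (Ideal.mem_span_singleton_self x)
  refine (pow_le_aux hIK hxK le_rfl n).trans (sup_le le_rfl ?_)
  rw [Ideal.span_singleton_le_iff_mem, eq_neg_of_add_eq_zero_left hx]
  refine neg_mem (Ideal.sum_mem _ fun j hj => ?_)
  rw [Finset.mem_Icc] at hj
  have h1 := ha j hj.1 hj.2
  have h2 : I ^ j * K ^ (n + 1 - j) ≤ I * K ^ n := by
    obtain ⟨k, rfl⟩ : ∃ k, j = k + 1 := ⟨j - 1, by omega⟩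
    rw [pow_succ', mul_assoc]
    refine Ideal.mul_mono_right ?_
    calc I ^ k * K ^ (n + 1 - (k + 1)) ≤ K ^ k * K ^ (n + 1 - (k + 1)) :=
          Ideal.mul_mono_left (Ideal.pow_right_mono hIK k)
      _ = K ^ n := by rw [← pow_add]; congr 1; omega
  exact h2 (Ideal.mul_mem_mul h1 (Ideal.pow_mem_pow hxK _))

lemma mem_idealIC_of_red [IsNoetherianRing R] {J K : Ideal R} {x : R} (hx : x ∈ K) (N : ℕ)
    (h : K ^ (N + 1) ≤ J * K ^ N) : x ∈ idealIC J := by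
  obtain ⟨p, hp, -, hpc, hpe⟩ :=
    LinearMap.exists_monic_and_natDegree_eq_and_coeff_mem_pow_and_aeval_eq_zero R
      (M := ↥(K ^ N)) (algebraMap R (Module.End R ↥(K ^ N)) x) J (by
        rintro _ ⟨y, rfl⟩
        rw [Submodule.mem_smul_top_iff]
        have h1 := h (pow_succ' K N ▸ Ideal.mul_mem_mul hx y.2)
        simpa using h1)
  rw [Polynomial.aeval_algebraMap_apply] at hpe
  have h2 := congrArg Subtype.val
    (LinearMap.congr_fun hpe ⟨x ^ N, Ideal.pow_mem_pow hx N⟩)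
  have h3 : p.eval x * x ^ N = 0 := by simpa [Polynomial.aeval_def] using h2
  set D := p.natDegree with hD
  refine mem_idealIC_of_sum (D + (N + 1)) (by omega)
    (fun k => if N + 1 ≤ k then p.coeff (k - (N + 1)) else 0) ?_ ?_
  · intro k hk
    split_ifs with h
    · have := hpc (k - (N + 1))
      rwa [show D + (N + 1) - k = D - (k - (N + 1)) by omega]
    · exact zero_mem _
  · have h4 : p.eval x = x ^ D + ∑ k ∈ Finset.range D, p.coeff k * x ^ k := by
      rw [Polynomial.eval_eq_sum_range, Finset.sum_range_succ, ← hD, hp.coeff_natDegree, one_mul,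
        add_comm]
    have h5 : ∑ k ∈ Finset.range (D + (N + 1)),
        (if N + 1 ≤ k then p.coeff (k - (N + 1)) else 0) * x ^ k =
        ∑ k ∈ Finset.range D, p.coeff k * x ^ (k + (N + 1)) := by
      rw [add_comm D, Finset.sum_range_add, Finset.sum_eq_zero, zero_add]
      · refine Finset.sum_congr rfl fun k _ => ?_
        rw [if_pos (by omega), show N + 1 + k - (N + 1) = k by omega, add_comm k]
      · intro k hk
        rw [Finset.mem_range] at hk
        rw [if_neg (by omega), zero_mul]
    rw [h5]
    have h6 : x ^ (D + (N + 1)) + ∑ k ∈ Finset.range D, p.coeff k * x ^ (k + (N + 1)) =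
        p.eval x * x ^ N * x := by
      rw [h4, add_mul, add_mul, Finset.sum_mul, Finset.sum_mul]
      congr 1
      · ring
      · exact Finset.sum_congr rfl fun k _ => by ring
    rw [h6, h3, zero_mul]

lemma idealIC_red [IsNoetherianRing R] {I J : Ideal R} {n : ℕ}
    (h : I ^ (n + 1) ≤ J * I ^ n) : idealIC I ⊆ idealIC J := by
  intro x hx
  obtain ⟨k, hk⟩ := exists_red_of_mem hx
  set K := I ⊔ Ideal.span {x} with hK
  have hIK : I ≤ K := le_sup_left
  have hxK : x ∈ K := Ideal.mem_sup_right (Ideal.mem_span_singleton_self x)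
  have h1 : ∀ r, K ^ (k + r) ≤ I ^ r * K ^ k := by
    intro r
    induction r with
    | zero => simp
    | succ r ih =>
      calc K ^ (k + (r + 1)) = K * K ^ (k + r) := by rw [← pow_succ']; rfl
        _ ≤ K * (I ^ r * K ^ k) := Ideal.mul_mono_right ih
        _ = I ^ r * K ^ (k + 1) := by ring
        _ ≤ I ^ r * (I * K ^ k) := Ideal.mul_mono_right hk
        _ = I ^ (r + 1) * K ^ k := by ring
  refine mem_idealIC_of_red hxK (k + n) ?_
  calc K ^ (k + n + 1) ≤ I ^ (n + 1) * K ^ k := h1 (n + 1)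
    _ ≤ J * I ^ n * K ^ k := Ideal.mul_mono_left h
    _ ≤ J * K ^ n * K ^ k := Ideal.mul_mono_left (Ideal.mul_mono_right (Ideal.pow_right_mono hIK n))
    _ = J * K ^ (k + n) := by ring

/-- existence of parameter reductions -/
lemma exists_param_red [IsLocalRing R] [IsNoetherianRing R]
    [Infinite (IsLocalRing.ResidueField R)]
    {d : ℕ} (hd : (d : WithBot ℕ∞) = ringKrullDim R) (m : ℕ) : ∀ (a : Fin m → R),
    (Ideal.span (Set.range a)).radical = IsLocalRing.maximalIdeal R →
    ∃ s : Fin d → R, Ideal.span (Set.range s) ≤ Ideal.span (Set.range a) ∧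
      (Ideal.span (Set.range s)).radical = IsLocalRing.maximalIdeal R ∧
      idealIC (Ideal.span (Set.range a)) ⊆ idealIC (Ideal.span (Set.range s)) := by
  induction m with
  | zero =>
    intro a ha
    have h0 : Ideal.span (Set.range a) = ⊥ := by simp
    have h1 : Ideal.span (Set.range (fun _ : Fin d => (0 : R))) = Ideal.span (Set.range a) := by
      rw [h0, Ideal.span_eq_bot]; rintro _ ⟨_, rfl⟩; rfl
    exact ⟨fun _ => 0, h1.le, by rw [h1, ha], by rw [h1]⟩
  | succ m ih =>
    intro a ha
    by_cases hdm : d < m + 1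
    · obtain ⟨a', n, h1, h2⟩ := red_step hd hdm a ha
      have h3 : (Ideal.span (Set.range a')).radical = IsLocalRing.maximalIdeal R := by
        rw [← ha]
        refine le_antisymm (Ideal.radical_mono h1) ?_
        rw [← Ideal.radical_pow (Ideal.span (Set.range a)) (Nat.succ_ne_zero n)]
        exact Ideal.radical_mono (h2.trans Ideal.mul_le_left)
      obtain ⟨s, h4, h5, h6⟩ := ih a' h3
      exact ⟨s, h4.trans h1, h5, (idealIC_red h2).trans h6⟩
    · have h1 : Ideal.span (Set.range (fun j : Fin d => if h : (j : ℕ) < m + 1 then a ⟨j, h⟩ else 0))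
          = Ideal.span (Set.range a) := by
        apply le_antisymm
        · rw [Ideal.span_le]
          rintro _ ⟨j, rfl⟩
          simp only
          split_ifs with h
          · exact Ideal.subset_span ⟨_, rfl⟩
          · exact zero_mem _
        · rw [Ideal.span_le]
          rintro _ ⟨j, rfl⟩
          refine Ideal.subset_span ⟨⟨j, by omega⟩, ?_⟩
          exact dif_pos j.2
      exact ⟨_, h1.le, by rw [h1, ha], by rw [h1]⟩

end Red

end LICProof
namespace LICProof

open LIC

section Lic

variable {R : Type*} [CommRing R]

lemma mk_mem_lic {I : Ideal R} {x : R} (hx : x ∈ idealIC I) :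
    Ideal.Quotient.mk I x ∈ lic (⊥ : Submodule R (R ⧸ I)) := by
  obtain ⟨n, a, hn, ha, hx⟩ := hx
  set o : R ⧸ I := Ideal.Quotient.mk I 1 with ho
  have hlc : ∀ y : R, Finsupp.linearCombination R (id : R ⧸ I → R ⧸ I) (Finsupp.single o y) =
      Ideal.Quotient.mk I y := by
    intro y
    rw [Finsupp.linearCombination_single, id, ho, ← Ideal.Quotient.mk_eq_mk,
      ← Submodule.Quotient.mk_smul, smul_eq_mul, mul_one, Ideal.Quotient.mk_eq_mk]
  have hemb : ∀ y : R, symEmb R (R ⧸ I) (Finsupp.single o y) =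
      MvPolynomial.C y * MvPolynomial.X o := by
    intro y
    rw [symEmb, Finsupp.linearCombination_single, MvPolynomial.smul_eq_C_mul]
  refine ⟨Finsupp.single o x, ?_, hlc x⟩
  change IsIntegral _ _
  set A := Algebra.adjoin R (symEmb R (R ⧸ I) ''
    (Submodule.comap (Finsupp.linearCombination R (id : R ⧸ I → R ⧸ I)) ⊥ : Submodule R _)) with hA
  have hmem1 : ∀ y ∈ I, MvPolynomial.C y * MvPolynomial.X o ∈ A := by
    intro y hy
    refine Algebra.subset_adjoin ⟨Finsupp.single o y, ?_, hemb y⟩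
    rw [SetLike.mem_coe, Submodule.mem_comap, hlc, Submodule.mem_bot]
    exact Ideal.Quotient.eq_zero_iff_mem.2 hy
  have hmem : ∀ j, ∀ y ∈ I ^ j, MvPolynomial.C y * MvPolynomial.X o ^ j ∈ A := by
    intro j
    induction j with
    | zero =>
      intro y _
      rw [pow_zero, mul_one]
      exact A.algebraMap_mem y
    | succ j ih =>
      intro y hy
      rw [pow_succ] at hy
      refine Submodule.mul_induction_on hy ?_ ?_
      · intro p hp q hq
        rw [map_mul, pow_succ, mul_mul_mul_comm]
        exact A.mul_mem (ih p hp) (hmem1 q hq)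
      · intro p q hp hq
        rw [map_add, add_mul]
        exact A.add_mem hp hq
  rw [hemb]
  classical
  let b : ℕ → A := fun j => if h : 1 ≤ j ∧ j ≤ n then
    ⟨MvPolynomial.C (a j) * MvPolynomial.X o ^ j, hmem j _ (ha j h.1 h.2)⟩ else 0
  have hb : ∀ j ∈ Finset.Icc 1 n, (b j : MvPolynomial (R ⧸ I) R) =
      MvPolynomial.C (a j) * MvPolynomial.X o ^ j := by
    intro j hj
    rw [Finset.mem_Icc] at hj
    simp only [b]
    rw [dif_pos hj]
  refine ⟨Polynomial.X ^ n + ∑ j ∈ Finset.Icc 1 n, Polynomial.C (b j) * Polynomial.X ^ (n - j),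
    ?_, ?_⟩
  · refine Polynomial.monic_X_pow_add ?_
    refine (Polynomial.degree_sum_le _ _).trans_lt ?_
    rw [Finset.sup_lt_iff (by exact WithBot.bot_lt_coe n)]
    intro j hj
    rw [Finset.mem_Icc] at hj
    refine (Polynomial.degree_C_mul_X_pow_le _ _).trans_lt ?_
    exact_mod_cast (by omega : n - j < n)
  · rw [Polynomial.eval₂_add, Polynomial.eval₂_finsetSum, Polynomial.eval₂_X_pow]
    have h1 : ∀ j ∈ Finset.Icc 1 n, Polynomial.eval₂ (algebraMap A (MvPolynomial (R ⧸ I) R))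
        (MvPolynomial.C x * MvPolynomial.X o) (Polynomial.C (b j) * Polynomial.X ^ (n - j)) =
        MvPolynomial.C (a j * x ^ (n - j)) * MvPolynomial.X o ^ n := by
      intro j hj
      rw [Polynomial.eval₂_mul, Polynomial.eval₂_C, Polynomial.eval₂_X_pow]
      change (b j : MvPolynomial (R ⧸ I) R) * _ = _
      rw [hb j hj]
      rw [Finset.mem_Icc] at hj
      obtain ⟨k, rfl⟩ := Nat.exists_eq_add_of_le hj.2
      rw [Nat.add_sub_cancel_left, map_mul, map_pow]
      ring
    rw [Finset.sum_congr rfl h1, ← Finset.sum_mul, mul_pow, ← map_sum, ← map_pow, ← add_mul,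
      ← map_add, hx, map_zero, zero_mul]

lemma exists_of_mem_lic [Nontrivial R] {M : Type*} [AddCommGroup M] [Module R M] {I : Ideal R}
    {z : M} (hz : z ∈ lic (⊥ : Submodule R M)) (ψ : M →ₗ[R] (R ⧸ I)) :
    ∃ x ∈ idealIC I, Ideal.Quotient.mk I x = ψ z := by
  obtain ⟨f, hf, rfl⟩ := hz
  choose g hg using fun m => Ideal.Quotient.mk_surjective (I := I) (ψ m)
  let G := Finsupp.linearCombination R g
  have hG : ∀ f, Ideal.Quotient.mk I (G f) = ψ (Finsupp.linearCombination R id f) := by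
    intro f
    simp only [G]
    rw [Finsupp.linearCombination_apply, Finsupp.linearCombination_apply, Finsupp.sum, Finsupp.sum,
      map_sum, map_sum]
    refine Finset.sum_congr rfl fun m _ => ?_
    rw [ψ.map_smul, id, ← hg, smul_eq_mul, map_mul, Algebra.smul_def]; rfl
  refine ⟨G f, ?_, hG f⟩
  let h : MvPolynomial M R →ₐ[R] Polynomial R :=
    MvPolynomial.aeval fun m => Polynomial.monomial 1 (g m)
  have hh : ∀ f, h (symEmb R M f) = Polynomial.monomial 1 (G f) := by
    intro f
    simp only [h, G, symEmb]
    rw [Finsupp.linearCombination_apply, Finsupp.linearCombination_apply, Finsupp.sum, Finsupp.sum,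
      map_sum, map_sum]
    refine Finset.sum_congr rfl fun m _ => ?_
    rw [map_smul, MvPolynomial.aeval_X, Polynomial.smul_monomial]
  change IsIntegral _ _ at hf
  set A := Algebra.adjoin R (symEmb R M ''
    (Submodule.comap (Finsupp.linearCombination R (id : M → M)) ⊥ : Submodule R _)) with hA
  have hAr : A ≤ (reesAlgebra I).comap h := by
    rw [hA, Algebra.adjoin_le_iff]
    rintro _ ⟨f, hf, rfl⟩
    rw [SetLike.mem_coe, Submodule.mem_comap, Submodule.mem_bot] at hf
    rw [SetLike.mem_coe, Subalgebra.mem_comap, hh, mem_reesAlgebra_iff]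
    intro i
    rw [Polynomial.coeff_monomial]
    split_ifs with hi
    · subst hi
      rw [pow_one, ← Ideal.Quotient.eq_zero_iff_mem, hG, hf, map_zero]
    · exact zero_mem _
  obtain ⟨p, hp, hpe⟩ := hf
  have hpe' := congrArg h hpe
  rw [Polynomial.eval₂_eq_sum_range, map_sum, map_zero, Finset.sum_range_succ,
    hp.coeff_natDegree, map_one, one_mul, map_pow, hh] at hpe'
  set D := p.natDegree with hD
  have hD0 : 0 < D := by
    by_contra h0
    have h1 : D = 0 := by omega
    rw [h1] at hpe'
    simp at hpe'
  refine mem_idealIC_of_sum D hD0 (fun k => (h (p.coeff k : MvPolynomial M R)).coeff (D - k)) ?_ ?_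
  · intro k _
    exact (mem_reesAlgebra_iff _ _).1 (hAr (p.coeff k).2) _
  · have h2 := congrArg (fun q => Polynomial.coeff q D) hpe'
    simp only [Polynomial.coeff_add, Polynomial.coeff_zero, Polynomial.finsetSum_coeff] at h2
    rw [add_comm, ← h2]
    congr 1
    · refine Finset.sum_congr rfl fun k hk => ?_
      rw [Finset.mem_range] at hk
      rw [map_mul, map_pow, hh, Polynomial.monomial_pow, one_mul]
      obtain ⟨l, hl⟩ := Nat.exists_eq_add_of_lt hk
      rw [show D = (l + 1) + k by omega, Polynomial.coeff_mul_monomial, Nat.add_sub_cancel]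
      rfl
    · rw [Polynomial.monomial_pow, one_mul, Polynomial.coeff_monomial, if_pos rfl]

end Lic

end LICProof
namespace LICProof

open LIC IsLocalRing

section Main

variable {R : Type u} [CommRing R] [IsLocalRing R] [IsNoetherianRing R]

lemma mem_colon {I : Ideal R} {S : Set R} {r : R} :
    r ∈ colonIdeal I S ↔ ∀ s ∈ S, r * s ∈ I := Iff.rfl

lemma primary_of_radical {I : Ideal R} (h : I.radical = maximalIdeal R) : I.IsPrimary :=
  Ideal.isPrimary_of_isMaximal_radical (h ▸ inferInstance)

lemma krull_quot (M : Type*) [AddCommGroup M] [Module R M] [Module.Finite R M] {z : M}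
    (h : ∀ N : ℕ, z ∈ (maximalIdeal R ^ N • ⊤ : Submodule R M)) : z = 0 := by
  have h1 := Ideal.iInf_pow_smul_eq_bot_of_isLocalRing (M := M) (maximalIdeal R)
    (Ideal.IsPrime.ne_top inferInstance)
  rw [← Submodule.mem_bot R, ← h1, Submodule.mem_iInf]
  exact h

lemma krull_sup {I : Ideal R} {y : R} (h : ∀ N : ℕ, y ∈ I ⊔ maximalIdeal R ^ N) : y ∈ I := by
  rw [← Ideal.Quotient.eq_zero_iff_mem]
  refine krull_quot (R := R) (R ⧸ I) fun N => ?_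
  obtain ⟨a, ha, b, hb, rfl⟩ := Submodule.mem_sup.1 (h N)
  rw [map_add, Ideal.Quotient.eq_zero_iff_mem.2 ha, zero_add]
  have : Ideal.Quotient.mk I b = b • (1 : R ⧸ I) := by
    rw [Algebra.smul_def, mul_one]; rfl
  rw [this]
  exact Submodule.smul_mem_smul hb trivial

lemma part_one :
    (⨅ (I : Ideal R) (_ : I.IsPrimary ∧ I.radical = maximalIdeal R), colonIdeal I (idealIC I)) ≤
      (⨅ I : Ideal R, colonIdeal I (idealIC I)) := by
  refine le_iInf fun I r hr => ?_
  rw [mem_colon]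
  intro x hx
  by_cases hI : I = ⊤
  · rw [hI]; trivial
  refine krull_sup fun N => ?_
  rcases Nat.eq_zero_or_pos N with h0 | h0
  · subst h0; simp
  have hrad : (I ⊔ maximalIdeal R ^ N).radical = maximalIdeal R := by
    apply le_antisymm
    · refine le_trans (b := (maximalIdeal R).radical) ?_
        (inferInstance : (maximalIdeal R).IsPrime).radical.le
      exact Ideal.radical_mono (sup_le (le_maximalIdeal hI) (Ideal.pow_le_self h0.ne'))
    · intro y hy
      exact ⟨N, Ideal.mem_sup_right (Ideal.pow_mem_pow hy N)⟩
  rw [Submodule.mem_iInf] at hr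
  have h1 := hr (I ⊔ maximalIdeal R ^ N)
  rw [Submodule.mem_iInf] at h1
  exact h1 ⟨primary_of_radical hrad, hrad⟩ x (idealIC_mono le_sup_left hx)

lemma exists_dim : ∃ d : ℕ, (d : WithBot ℕ∞) = ringKrullDim R := by
  have h1 := IsLocalRing.maximalIdeal_height_eq_ringKrullDim (R := R)
  have h2 : (maximalIdeal R).height ≠ ⊤ := Ideal.height_ne_top (Ideal.IsPrime.ne_top inferInstance)
  obtain ⟨d, hd⟩ := ENat.ne_top_iff_exists.1 h2
  refine ⟨d, ?_⟩
  rw [← h1, ← hd]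
  rfl

lemma part_two [Infinite (ResidueField R)] :
    (⨅ (J : Ideal R) (_ : (J.IsPrimary ∧ J.radical = maximalIdeal R) ∧
          ∃ (n : ℕ) (s : Fin n → R), (n : WithBot ℕ∞) = ringKrullDim R ∧
            J = Ideal.span (Set.range s)), colonIdeal J (idealIC J)) ≤
      (⨅ I : Ideal R, colonIdeal I (idealIC I)) := by
  refine le_trans ?_ part_one
  refine le_iInf₂ fun I hI r hr => ?_
  intro x hx
  obtain ⟨d, hd⟩ := exists_dim (R := R)
  obtain ⟨m, a, ha⟩ := Submodule.fg_iff_exists_fin_generating_family.1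
    (IsNoetherian.noetherian I)
  change Ideal.span (Set.range a) = I at ha
  subst ha
  obtain ⟨s, h1, h2, h3⟩ := exists_param_red hd m a hI.2
  rw [Submodule.mem_iInf] at hr
  have h4 := hr (Ideal.span (Set.range s))
  rw [Submodule.mem_iInf] at h4
  exact h1 (h4 ⟨⟨primary_of_radical h2, h2⟩, d, s, hd, rfl⟩ x (h3 hx))

lemma part_three :
    sInf {J : Ideal R | ∃ (M : Type u) (_ : AddCommGroup M) (_ : Module R M),
        Module.Finite R M ∧ J = (lic (⊥ : Submodule R M)).annihilator} ≤
      (⨅ I : Ideal R, colonIdeal I (idealIC I)) := by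
  refine le_iInf fun I r hr => ?_
  intro x hx
  rw [Submodule.mem_sInf] at hr
  have h1 := hr _ ⟨R ⧸ I, inferInstance, inferInstance, inferInstance, rfl⟩
  have h2 := Submodule.mem_annihilator.1 h1 _ (mk_mem_lic hx)
  rw [← Ideal.Quotient.eq_zero_iff_mem, map_mul, ← h2, Algebra.smul_def]
  rfl

lemma tau_smul {r : R} (hr : r ∈ ⨅ I : Ideal R, colonIdeal I (idealIC I)) {I : Ideal R}
    {x : R} (hx : x ∈ idealIC I) : r * x ∈ I := by
  rw [Submodule.mem_iInf] at hr
  exact hr I x hx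

lemma part_four_gor (hG : ApproximatelyGorenstein R) (M : Type*) [AddCommGroup M] [Module R M]
    [Module.Finite R M] {r : R} (hr : r ∈ ⨅ I : Ideal R, colonIdeal I (idealIC I)) {z : M}
    (hz : z ∈ lic (⊥ : Submodule R M)) : r • z = 0 := by
  obtain ⟨I, hI, hc⟩ := hG
  refine krull_quot (R := R) M fun N => ?_
  obtain ⟨t, ht⟩ := hc N
  refine Submodule.smul_mono_left ht ?_
  by_contra hn
  obtain ⟨ψ, hψ⟩ := exists_dual (I t) (hI t).2.1 (hI t).2.2 (r • z) hn
  obtain ⟨x, hx, hxz⟩ := exists_of_mem_lic hz ψ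
  apply hψ
  rw [map_smul, ← hxz, Algebra.smul_def]
  change Ideal.Quotient.mk (I t) r * Ideal.Quotient.mk (I t) x = 0
  rw [← map_mul, Ideal.Quotient.eq_zero_iff_mem]
  exact tau_smul hr hx

lemma part_four_zero (h0 : ringKrullDim R = 0) (M : Type*) [AddCommGroup M] [Module R M]
    [Module.Finite R M] {r : R} (hr : r ∈ ⨅ I : Ideal R, colonIdeal I (idealIC I)) {z : M}
    (hz : z ∈ lic (⊥ : Submodule R M)) : r • z = 0 := by
  have hdim : Ring.KrullDimLE 0 R := Ring.krullDimLE_iff.2 (by simp [h0])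
  have hnil : ∀ y ∈ maximalIdeal R, IsNilpotent y := by
    intro y hy
    rwa [← mem_nilradical, Ring.KrullDimLE.nilradical_eq_maximalIdeal]
  have hrm : ∀ y ∈ maximalIdeal R, r * y = 0 := by
    intro y hy
    obtain ⟨n, hn⟩ := hnil y hy
    rw [← Ideal.mem_bot]
    refine tau_smul hr (mem_idealIC_of_sum (n + 1) (by omega) (fun _ => 0)
      (fun _ _ => zero_mem _) ?_)
    simp [pow_succ, hn]
  have hzm : z ∈ (maximalIdeal R • ⊤ : Submodule R M) := by
    by_contra hn
    obtain ⟨ψ, hψ⟩ := exists_dual (maximalIdeal R)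
      (inferInstance : (maximalIdeal R).IsPrime).radical (by
        intro J K hJK
        by_contra h
        push Not at h
        have hJ : J = ⊤ := by
          by_contra hJ
          exact h.1 (le_antisymm (hJK.le.trans inf_le_left) (le_maximalIdeal hJ))
        rw [hJ, top_inf_eq] at hJK
        exact h.2 hJK) z hn
    obtain ⟨x, hx, hxz⟩ := exists_of_mem_lic hz ψ
    apply hψ
    rw [← hxz, Ideal.Quotient.eq_zero_iff_mem]
    obtain ⟨n, a, hn0, ha, he⟩ := hx
    refine (inferInstance : (maximalIdeal R).IsPrime).mem_of_pow_mem n ?_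
    rw [eq_neg_of_add_eq_zero_left he]
    refine neg_mem (Ideal.sum_mem _ fun j hj => Ideal.mul_mem_right _ _ ?_)
    rw [Finset.mem_Icc] at hj
    exact Ideal.pow_le_self (by omega) (ha j hj.1 hj.2)
  refine Submodule.smul_induction_on hzm ?_ ?_
  · intro y hy w _
    rw [smul_smul, hrm y hy, zero_smul]
  · intro p q hp hq
    rw [smul_add, hp, hq, add_zero]

end Main

end LICProof


/-- For a Noetherian local ring `(R,m,k)`, with
`τ_I := ⋂_I (I :_R Ī)` (over all ideals `I`): (i) `τ_I` equals the intersection over all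
`m`-primary ideals; (ii) `τ_I` is contained in the intersection of `(J :_R J̄)` over all
`m`-primary ideals generated by a system of parameters, with equality if `k` is
infinite; (iii) `τ_M := ⋂_{M f.g.} ann lic(0,M)` satisfies `τ_M ⊆ τ_I`, with equality
if `dim R = 0` or `R` is approximately Gorenstein. -/
theorem tau_I_characterizations {R : Type u} [CommRing R] [IsLocalRing R]
    [IsNoetherianRing R] :
    (⨅ I : Ideal R, LIC.colonIdeal I (LIC.idealIC I)) =
      (⨅ (I : Ideal R) (_ : I.IsPrimary ∧ I.radical = IsLocalRing.maximalIdeal R),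
        LIC.colonIdeal I (LIC.idealIC I)) ∧
    ((⨅ I : Ideal R, LIC.colonIdeal I (LIC.idealIC I)) ≤
      (⨅ (J : Ideal R) (_ : (J.IsPrimary ∧ J.radical = IsLocalRing.maximalIdeal R) ∧
          ∃ (n : ℕ) (s : Fin n → R), (n : WithBot ℕ∞) = ringKrullDim R ∧
            J = Ideal.span (Set.range s)),
        LIC.colonIdeal J (LIC.idealIC J)) ∧
      (Infinite (IsLocalRing.ResidueField R) →
        (⨅ I : Ideal R, LIC.colonIdeal I (LIC.idealIC I)) =
          (⨅ (J : Ideal R) (_ : (J.IsPrimary ∧ J.radical = IsLocalRing.maximalIdeal R) ∧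
              ∃ (n : ℕ) (s : Fin n → R), (n : WithBot ℕ∞) = ringKrullDim R ∧
                J = Ideal.span (Set.range s)),
            LIC.colonIdeal J (LIC.idealIC J)))) ∧
    (sInf {J : Ideal R | ∃ (M : Type u) (_ : AddCommGroup M) (_ : Module R M),
        Module.Finite R M ∧ J = (LIC.lic (⊥ : Submodule R M)).annihilator} ≤
      (⨅ I : Ideal R, LIC.colonIdeal I (LIC.idealIC I)) ∧
      ((ringKrullDim R = 0 ∨ LIC.ApproximatelyGorenstein R) →
        sInf {J : Ideal R | ∃ (M : Type u) (_ : AddCommGroup M) (_ : Module R M),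
            Module.Finite R M ∧ J = (LIC.lic (⊥ : Submodule R M)).annihilator} =
          (⨅ I : Ideal R, LIC.colonIdeal I (LIC.idealIC I)))) := by
  refine ⟨le_antisymm (le_iInf₂ fun I _ => iInf_le _ I) LICProof.part_one,
    ⟨le_iInf₂ fun I _ => iInf_le _ I, fun _ => le_antisymm (le_iInf₂ fun I _ => iInf_le _ I)
      LICProof.part_two⟩, LICProof.part_three, fun h => le_antisymm LICProof.part_three ?_⟩
  refine le_sInf ?_
  rintro _ ⟨M, _, _, _, rfl⟩ r hr
  rw [Submodule.mem_annihilator]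
  intro z hz
  rcases h with h | h
  · exact LICProof.part_four_zero h M hr hz
  · exact LICProof.part_four_gor h M hr hz
end

section
/- Let (R,m) be a Noetherian local ring. The following are equivalent: (1) dim R = 0; (2) for every finitely generated R-module M, lic(0,M) = mM; (3) for every inclusion of R-modules L ⊆ M with M/L finitely generated, lic(L,M) = L + mM. -/
namespace LIC

theorem apply_symEmb {R : Type*} [CommRing R] {M : Type*} [AddCommGroup M] [Module R M]
    {k : Type*} [Field k] [Algebra R k] (g : M →ₗ[R] k) (y : M →₀ R) :
    MvPolynomial.aeval (R := R) (fun m : M => Polynomial.C (g m) * Polynomial.X) (symEmb R M y)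
      = Polynomial.C (g (Finsupp.linearCombination R (id : M → M) y)) * Polynomial.X := by
  induction y using Finsupp.induction_linear with
  | zero => simp
  | add a b ha hb => simp [map_add, ha, hb, add_mul]
  | single m r =>
    simp [symEmb, Algebra.smul_def, Polynomial.algebraMap_apply, mul_assoc]

/-- A linear functional to a field killing `L` kills `lic L`. -/
theorem functional_lic {R : Type*} [CommRing R] {M : Type*} [AddCommGroup M] [Module R M]
    {k : Type*} [Field k] [Algebra R k] (g : M →ₗ[R] k) (L : Submodule R M)
    (hL : ∀ x ∈ L, g x = 0) (x : M) (hx : x ∈ lic L) : g x = 0 := by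
  obtain ⟨y, hy, rfl⟩ := hx
  set U := Submodule.comap (Finsupp.linearCombination R (id : M → M)) L with hU
  let φ : MvPolynomial M R →ₐ[R] Polynomial k :=
    MvPolynomial.aeval (R := R) (fun m : M => Polynomial.C (g m) * Polynomial.X)
  have hA : Algebra.adjoin R (symEmb R M '' U) ≤ (⊥ : Subalgebra R (Polynomial k)).comap φ := by
    rw [Algebra.adjoin_le_iff]
    rintro _ ⟨u, hu, rfl⟩
    have h0 : φ (symEmb R M u) = 0 := by
      rw [apply_symEmb, hL _ hu]; simp
    change φ (symEmb R M u) ∈ (⊥ : Subalgebra R (Polynomial k))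
    rw [h0]; exact zero_mem _
  have hy' : IsIntegral (Algebra.adjoin R (symEmb R M '' U)) (symEmb R M y) := hy
  let ψ : (Algebra.adjoin R (symEmb R M '' U)) →+* k :=
    Polynomial.constantCoeff.comp (φ.toRingHom.comp (Algebra.adjoin R (symEmb R M '' U)).val.toRingHom)
  have hint : IsIntegral k (φ (symEmb R M y)) := by
    refine IsIntegral.map_of_comp_eq ψ φ.toRingHom ?_ hy'
    ext1 s
    obtain ⟨r, hr⟩ := Algebra.mem_bot.1 (hA s.2)
    have hr' : φ s.1 = Polynomial.C (algebraMap R k r) := hr.symm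
    change Polynomial.C (Polynomial.constantCoeff (φ s.1)) = φ s.1
    rw [hr']; simp
  rw [apply_symEmb] at hint
  by_contra hc
  have h1 := (isIntegral_algebraMap (R := k) (A := Polynomial k)
    (x := (g (Finsupp.linearCombination R (id : M → M) y))⁻¹)).mul hint
  have h2 : IsIntegral k (Polynomial.X : Polynomial k) := by
    rw [Polynomial.algebraMap_eq, ← mul_assoc, ← Polynomial.C_mul, inv_mul_cancel₀ hc,
      Polynomial.C_1, one_mul] at h1
    exact h1
  exact Polynomial.transcendental_X k h2.isAlgebraic

theorem le_lic {R : Type*} [CommRing R] {M : Type*} [AddCommGroup M] [Module R M]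
    (L : Submodule R M) : L ≤ lic L := by
  intro x hx
  refine ⟨Finsupp.single x 1, ?_, by simp⟩
  have hmem : symEmb R M (Finsupp.single x 1) ∈ Algebra.adjoin R (symEmb R M ''
      (Submodule.comap (Finsupp.linearCombination R (id : M → M)) L)) :=
    Algebra.subset_adjoin ⟨Finsupp.single x 1, by simpa using hx, rfl⟩
  exact isIntegral_algebraMap (R := Algebra.adjoin R (symEmb R M ''
      (Submodule.comap (Finsupp.linearCombination R (id : M → M)) L))) (x := ⟨_, hmem⟩)

theorem nil_le_lic {R : Type*} [CommRing R] {M : Type*} [AddCommGroup M] [Module R M]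
    (L : Submodule R M) : nilradical R • (⊤ : Submodule R M) ≤ lic L := by
  rw [Submodule.smul_le]
  rintro a ha x -
  refine ⟨Finsupp.single x a, ?_, by simp⟩
  obtain ⟨n, hn⟩ := (mem_nilradical.1 ha)
  change IsIntegral _ _
  refine IsIntegral.of_pow (n := n + 1) (Nat.succ_pos n) ?_
  have : (symEmb R M (Finsupp.single x a)) ^ (n + 1) = 0 := by
    simp [symEmb, smul_pow, pow_succ, hn]
  rw [this]; exact isIntegral_zero

theorem lic_le {R : Type*} [CommRing R] [IsLocalRing R] {M : Type*} [AddCommGroup M] [Module R M]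
    (L : Submodule R M) : lic L ≤ L ⊔ (IsLocalRing.maximalIdeal R) • (⊤ : Submodule R M) := by
  intro x hx
  by_contra hn
  set N := L ⊔ (IsLocalRing.maximalIdeal R) • (⊤ : Submodule R M) with hN
  have htors : Module.IsTorsionBySet R (M ⧸ N) (IsLocalRing.maximalIdeal R : Set R) := by
    rintro q ⟨a, ha⟩
    obtain ⟨z, rfl⟩ := N.mkQ_surjective q
    change a • N.mkQ z = 0
    rw [← map_smul, Submodule.mkQ_apply, Submodule.Quotient.mk_eq_zero]
    exact (le_sup_right : _ ≤ N) (Submodule.smul_mem_smul ha trivial)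
  let _ : Module (IsLocalRing.ResidueField R) (M ⧸ N) := htors.module
  have : IsScalarTower R (IsLocalRing.ResidueField R) (M ⧸ N) := htors.isScalarTower
  have hx0 : N.mkQ x ≠ 0 := by
    rwa [Ne, Submodule.mkQ_apply, Submodule.Quotient.mk_eq_zero]
  obtain ⟨f, hf⟩ : ∃ f : Module.Dual (IsLocalRing.ResidueField R) (M ⧸ N), f (N.mkQ x) ≠ 0 := by
    by_contra! h
    exact hx0 ((Module.forall_dual_apply_eq_zero_iff (IsLocalRing.ResidueField R) _).1 h)
  refine hf (functional_lic ((f.restrictScalars R).comp N.mkQ) L ?_ x hx)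
  intro l hl
  have : N.mkQ l = 0 := by
    rw [Submodule.mkQ_apply, Submodule.Quotient.mk_eq_zero]
    exact (le_sup_left : _ ≤ N) hl
  simp [this]

theorem lic_eq {R : Type*} [CommRing R] [IsLocalRing R] (h : ringKrullDim R = 0)
    {M : Type*} [AddCommGroup M] [Module R M] (L : Submodule R M) :
    lic L = L ⊔ (IsLocalRing.maximalIdeal R) • (⊤ : Submodule R M) := by
  refine le_antisymm (lic_le L) (sup_le (le_lic L) ?_)
  have : Ring.KrullDimLE 0 R := by
    rw [Ring.krullDimLE_iff, h]; simp
  rw [← Ring.KrullDimLE.nilradical_eq_maximalIdeal R]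
  exact nil_le_lic L

theorem dim_zero {R : Type*} [CommRing R] [IsLocalRing R]
    (h : lic (⊥ : Submodule R R) = (IsLocalRing.maximalIdeal R) • (⊤ : Submodule R R)) :
    ringKrullDim R = 0 := by
  have key : ∀ p : Ideal R, p.IsPrime → p.IsMaximal := by
    intro p hp
    have : IsLocalRing.maximalIdeal R ≤ p := by
      intro a ha
      have ha' : a ∈ lic (⊥ : Submodule R R) := by
        rw [h]; simpa using ha
      have := functional_lic (Algebra.linearMap R p.ResidueField) ⊥ (by simp) a ha'
      simpa using this
    rw [← (IsLocalRing.maximalIdeal.isMaximal R).eq_of_le hp.ne_top this]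
    infer_instance
  have : Ring.KrullDimLE 0 R := Ring.krullDimLE_zero_iff.2 key
  exact ringKrullDimZero_iff_ringKrullDim_eq_zero.1 this

end LIC

universe u

/-- For a Noetherian local ring `(R,m)`, the following are equivalent:
(1) `dim R = 0`; (2) `lic(0,M) = mM` for every finitely generated `M`; (3)
`lic(L,M) = L + mM` for every inclusion `L ⊆ M` with `M/L` finitely generated. -/
theorem dim_eq_zero_iff_lic {R : Type u} [CommRing R] [IsLocalRing R]
    [IsNoetherianRing R] :
    ((ringKrullDim R = 0) ↔
      ∀ (M : Type u) (_ : AddCommGroup M) (_ : Module R M), Module.Finite R M →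
        LIC.lic (⊥ : Submodule R M) = (IsLocalRing.maximalIdeal R) • (⊤ : Submodule R M)) ∧
    ((ringKrullDim R = 0) ↔
      ∀ (M : Type u) (_ : AddCommGroup M) (_ : Module R M) (L : Submodule R M),
        Module.Finite R (M ⧸ L) →
        LIC.lic L = L ⊔ (IsLocalRing.maximalIdeal R) • (⊤ : Submodule R M)) := by
  refine ⟨⟨fun h M _ _ _ => ?_, fun h => LIC.dim_zero (h R _ _ inferInstance)⟩,
    ⟨fun h M _ _ L _ => LIC.lic_eq h L, fun h => LIC.dim_zero ?_⟩⟩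
  · rw [LIC.lic_eq h, bot_sup_eq]
  · rw [h R _ _ ⊥ inferInstance, bot_sup_eq]
end

section
/- Let (R,m) be a Noetherian local ring of Krull dimension 0. Then τ_I = τ_M = Soc R, the socle (0 :_R m) of R. Here τ_I := ∩_I (I :_R Ī), the intersection over all ideals I of R with Ī the integral closure of the ideal I, and τ_M := ∩_M ann_R lic(0,M), the intersection over all finitely generated R-modules M. -/
universe u

namespace LIC

lemma isNilpotent_of_mem_max {R : Type*} [CommRing R] [IsLocalRing R]
    (hdim : ringKrullDim R = 0) {x : R} (hx : x ∈ IsLocalRing.maximalIdeal R) :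
    IsNilpotent x := by
  have : Ring.KrullDimLE 0 R := (Ring.krullDimLE_iff).2 (by simp [hdim])
  rw [← mem_nilradical, nilradical_eq_sInf, Submodule.mem_sInf]
  intro J hJ
  have hJp : Ideal.IsPrime J := hJ
  rw [Ring.KrullDimLE.eq_maximalIdeal_of_isPrime J]
  exact hx

lemma exists_functional {R : Type u} [CommRing R] [IsLocalRing R]
    {M : Type*} [AddCommGroup M] [Module R M] {x : M}
    (hx : x ∉ (IsLocalRing.maximalIdeal R) • (⊤ : Submodule R M)) :
    ∃ (k : Type u) (_ : Field k) (_ : Algebra R k) (φ : M →ₗ[R] k), φ x ≠ 0 := by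
  letI : Field (R ⧸ IsLocalRing.maximalIdeal R) := Ideal.Quotient.field _
  refine ⟨R ⧸ IsLocalRing.maximalIdeal R, inferInstance, inferInstance, ?_⟩
  have h0 : ((IsLocalRing.maximalIdeal R) • (⊤ : Submodule R M)).mkQ x ≠ 0 := by
    simpa using hx
  by_contra! hcon
  apply h0
  rw [← Module.forall_dual_apply_eq_zero_iff (R ⧸ IsLocalRing.maximalIdeal R)]
  intro ψ
  exact hcon ((ψ.restrictScalars R).comp
    ((IsLocalRing.maximalIdeal R) • (⊤ : Submodule R M)).mkQ)

lemma lic_bot_le {R : Type*} [CommRing R] [IsLocalRing R]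
    {M : Type*} [AddCommGroup M] [Module R M] :
    lic (⊥ : Submodule R M) ≤ (IsLocalRing.maximalIdeal R) • (⊤ : Submodule R M) := by
  rintro x ⟨z, hz, rfl⟩
  by_contra hx
  obtain ⟨k, _, _, φ, hφ⟩ := exists_functional hx
  let g : MvPolynomial M R →ₐ[R] Polynomial k :=
    MvPolynomial.aeval (fun m => Polynomial.C (φ m) * Polynomial.X)
  have hg : ∀ w : M →₀ R, g (symEmb R M w) =
      Polynomial.C (φ (Finsupp.linearCombination R id w)) * Polynomial.X := by
    intro w
    induction w using Finsupp.induction_linear with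
    | zero => simp
    | add a b ha hb => simp [ha, hb, add_mul]
    | single m r =>
      simp [symEmb, g, Algebra.smul_def, Polynomial.algebraMap_apply, mul_assoc]
  let A := Algebra.adjoin R (symEmb R M ''
    (Submodule.comap (Finsupp.linearCombination R (id : M → M)) ⊥ : Submodule R (M →₀ R)))
  have hA : ∀ a ∈ A, Polynomial.C ((g a).eval 0) = g a := by
    intro a ha
    induction ha using Algebra.adjoin_induction with
    | mem y hy =>
      obtain ⟨w, hw, rfl⟩ := hy
      have hw' : Finsupp.linearCombination R (id : M → M) w = 0 := by simpa using hw
      simp [hg, hw']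
    | algebraMap r => simp [Polynomial.algebraMap_apply]
    | add a b _ _ ha hb => simp only [map_add, Polynomial.eval_add, ha, hb]
    | mul a b _ _ ha hb => simp only [map_mul, Polynomial.eval_mul, ha, hb]
  have hz' : IsIntegral A (symEmb R M z) := hz
  have hi : IsIntegral k (g (symEmb R M z)) := by
    refine IsIntegral.map_of_comp_eq
      ((Polynomial.evalRingHom (0 : k)).comp ((g : MvPolynomial M R →+* Polynomial k).comp
        (algebraMap A (MvPolynomial M R)))) (g : MvPolynomial M R →+* Polynomial k) ?_ hz'
    ext1 a
    exact hA a a.2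
  rw [hg] at hi
  have h2 : IsIntegral k (Polynomial.X : Polynomial k) := by
    have := (isIntegral_algebraMap (R := k) (A := Polynomial k)
      (x := (φ (Finsupp.linearCombination R id z))⁻¹)).mul hi
    rwa [Polynomial.algebraMap_eq, ← mul_assoc, ← Polynomial.C_mul, inv_mul_cancel₀ hφ,
      Polynomial.C_1, one_mul] at this
  exact Polynomial.transcendental_X k h2.isAlgebraic

end LIC


/-- For a Noetherian local ring `(R,m)` of Krull dimension `0`,
`τ_I = τ_M = Soc R = (0 :_R m)`, where `τ_I := ⋂_I (I :_R Ī)` over all ideals `I`, and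
`τ_M := ⋂_M ann lic(0,M)` over all finitely generated modules `M`. -/
theorem tau_eq_socle_of_dim_zero {R : Type u} [CommRing R] [IsLocalRing R]
    [IsNoetherianRing R] (hdim : ringKrullDim R = 0) :
    (⨅ I : Ideal R, LIC.colonIdeal I (LIC.idealIC I)) =
        LIC.colonIdeal ⊥ ((IsLocalRing.maximalIdeal R : Ideal R) : Set R) ∧
    sInf {J : Ideal R | ∃ (M : Type u) (_ : AddCommGroup M) (_ : Module R M),
        Module.Finite R M ∧ J = (LIC.lic (⊥ : Submodule R M)).annihilator} =
      LIC.colonIdeal ⊥ ((IsLocalRing.maximalIdeal R : Ideal R) : Set R) := by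
  constructor
  · apply le_antisymm
    · intro r hr s hs
      have h := (Submodule.mem_iInf _).1 hr ⊥
      refine h s ?_
      obtain ⟨n, hn⟩ := LIC.isNilpotent_of_mem_max hdim hs
      exact ⟨n + 1, 0, by simp, by simp, by simp [pow_succ, hn]⟩
    · intro r hr
      refine (Submodule.mem_iInf _).2 fun I s hs => ?_
      by_cases hI : I = ⊤
      · simp [hI]
      obtain ⟨n, a, hn, ha, he⟩ := hs
      have hIm := IsLocalRing.le_maximalIdeal hI
      have hsm : s ∈ IsLocalRing.maximalIdeal R := by
        have hsum : ∑ j ∈ Finset.Icc 1 n, a j * s ^ (n - j) ∈ IsLocalRing.maximalIdeal R := by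
          refine Ideal.sum_mem _ fun j hj => Ideal.mul_mem_right _ _ (hIm ?_)
          rw [Finset.mem_Icc] at hj
          exact Ideal.pow_le_self (by omega) (ha j hj.1 hj.2)
        refine Ideal.IsPrime.mem_of_pow_mem inferInstance n ?_
        rw [eq_neg_of_add_eq_zero_left he]
        exact neg_mem hsum
      have h0 : r * s = 0 := by simpa using hr s hsm
      simp [h0]
  · apply le_antisymm
    · intro r hr s hs
      have h := (Submodule.mem_sInf).1 hr _ ⟨R, inferInstance, inferInstance, inferInstance, rfl⟩
      rw [Submodule.mem_annihilator] at h
      have hl : s ∈ LIC.lic (⊥ : Submodule R R) := by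
        refine ⟨Finsupp.single 1 s, ?_, by simp⟩
        obtain ⟨n, hn⟩ := LIC.isNilpotent_of_mem_max hdim hs
        have hnil : (LIC.symEmb R R (Finsupp.single 1 s)) ^ (n + 1) = 0 := by
          simp [LIC.symEmb, smul_pow, pow_succ, hn]
        refine IsIntegral.of_pow (Nat.succ_pos n) ?_
        rw [hnil]
        exact isIntegral_zero
      simpa using h s hl
    · intro r hr
      rw [Submodule.mem_sInf]
      rintro J ⟨M, _, _, _, rfl⟩
      rw [Submodule.mem_annihilator]
      intro x hx
      refine Submodule.smul_induction_on (LIC.lic_bot_le hx) ?_ ?_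
      · intro s hs y _
        have h0 : r * s = 0 := by simpa using hr s hs
        rw [← mul_smul, h0, zero_smul]
      · intro a b ha hb
        rw [smul_add, ha, hb, add_zero]
end

section
/- Let (R,m) be a Noetherian local ring of Krull dimension 1 with infinite residue field, and let τ_I := ∩_I (I :_R Ī), the intersection over all ideals I of R with Ī the integral closure of the ideal I. Then R is Cohen–Macaulay if and only if τ_I equals the conductor c_R := (R :_R R̄), where R̄ is the integral closure of R in its total ring of fractions; and if R is not Cohen–Macaulay, then c_R = R while τ_I is a proper ideal of R. -/
namespace LIC

/-- The conductor `c_R = (R :_R R̄)` of `R`, where `R̄` is the integral closure of `R` in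
its total ring of fractions: elements `r` such that `r R̄ ⊆ R` (inside `Frac R`). -/
def conductor (R : Type*) [CommRing R] : Ideal R where
  carrier := {r | ∀ x ∈ integralClosure R (FractionRing R),
      algebraMap R (FractionRing R) r * x ∈ Set.range (algebraMap R (FractionRing R))}
  zero_mem' := by
    intro x _
    exact ⟨0, by simp⟩
  add_mem' := by
    intro a b ha hb x hx
    obtain ⟨u, hu⟩ := ha x hx
    obtain ⟨v, hv⟩ := hb x hx
    exact ⟨u + v, by rw [map_add, hu, hv, map_add, add_mul]⟩
  smul_mem' := by
    intro c r hr x hx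
    obtain ⟨u, hu⟩ := hr x hx
    exact ⟨c * u, by rw [map_mul, hu, smul_eq_mul, map_mul, mul_assoc]⟩

/-- A Noetherian local ring is Cohen–Macaulay if `depth R = dim R`, i.e. there is a
regular sequence in the maximal ideal of length `dim R`. -/
def IsCohenMacaulayLocalRing (R : Type*) [CommRing R] [IsLocalRing R] : Prop :=
  ∃ rs : List R, (∀ r ∈ rs, r ∈ IsLocalRing.maximalIdeal R) ∧
    RingTheory.Sequence.IsRegular R rs ∧ (rs.length : WithBot ℕ∞) = ringKrullDim R

end LIC

namespace LIC

open Polynomial IsLocalRing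

section aux

variable {R : Type*} [CommRing R]

lemma isIntegral_of_eq {A B : Type*} [CommRing A] [CommRing B] [Algebra A B] (n : ℕ)
    (b : ℕ → A) (w : B)
    (h : w ^ n + ∑ j ∈ Finset.Icc 1 n, algebraMap A B (b j) * w ^ (n - j) = 0) :
    IsIntegral A w := by
  nontriviality A
  refine ⟨X ^ n + ∑ j ∈ Finset.Icc 1 n, C (b j) * X ^ (n - j), ?_, ?_⟩
  · apply monic_X_pow_add
    rw [← mem_degreeLT]
    refine Submodule.sum_mem _ fun j hj => ?_
    rw [mem_degreeLT]
    rw [Finset.mem_Icc] at hj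
    refine (degree_C_mul_X_pow_le _ _).trans_lt ?_
    exact_mod_cast (by omega : n - j < n)
  · simpa [eval₂_finsetSum] using h

lemma mem_idealIC_of_monic (b a : R) (q : R[X]) (hq : q.Monic) (h0 : 0 < q.natDegree)
    (hc : ∀ i ≤ q.natDegree, q.coeff i ∈ Ideal.span {b} ^ (q.natDegree - i))
    (ha : q.eval a = 0) : a ∈ idealIC (Ideal.span {b}) := by
  refine ⟨q.natDegree, fun j => q.coeff (q.natDegree - j), h0, ?_, ?_⟩
  · intro j h1 h2
    have := hc (q.natDegree - j) (by omega)
    rwa [show q.natDegree - (q.natDegree - j) = j by omega] at this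
  · rw [hq.as_sum] at ha
    simp only [eval_add, eval_pow, eval_X, eval_finsetSum, eval_mul, eval_C] at ha
    rw [← ha]
    congr 1
    refine Finset.sum_bij' (fun j _ => q.natDegree - j) (fun j _ => q.natDegree - j)
      ?_ ?_ ?_ ?_ ?_ <;> intro j hj <;> simp only [Finset.mem_Icc, Finset.mem_range] at * <;>
      omega

lemma tau_le_conductor :
    (⨅ I : Ideal R, colonIdeal I (idealIC I)) ≤ conductor R := by
  nontriviality R
  intro r hr x hx
  obtain ⟨a, b, rfl⟩ := IsLocalization.exists_mk'_eq (nonZeroDivisors R) x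
  obtain ⟨p, hp, hpx⟩ := hx
  have h1 : aeval (algebraMap R (FractionRing R) a) (scaleRoots p (b : R)) = 0 :=
    scaleRoots_aeval_eq_zero_of_aeval_mk'_eq_zero hpx
  rw [aeval_algebraMap_apply] at h1
  have h2 : (scaleRoots p (b : R)).eval a = 0 := by
    apply IsFractionRing.injective R (FractionRing R)
    rw [map_zero]; simpa using h1
  have h0 : 0 < p.natDegree := by
    rw [Nat.pos_iff_ne_zero]
    intro h
    rw [hp.natDegree_eq_zero] at h
    simp [h] at hpx
  have hmem : a ∈ idealIC (Ideal.span {(b : R)}) := by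
    refine mem_idealIC_of_monic _ _ (scaleRoots p (b : R)) ?_ ?_ ?_ h2
    · exact (monic_scaleRoots_iff _).2 hp
    · rwa [natDegree_scaleRoots]
    · intro i hi
      rw [coeff_scaleRoots, natDegree_scaleRoots, Ideal.span_singleton_pow]
      exact Ideal.mul_mem_left _ _ (Ideal.mem_span_singleton_self _)
  have := (Submodule.mem_iInf _).1 hr (Ideal.span {(b : R)}) a hmem
  obtain ⟨c, hc⟩ := Ideal.mem_span_singleton.1 this
  refine ⟨c, ?_⟩
  rw [IsLocalization.mul_mk'_eq_mk'_of_mul, IsLocalization.eq_mk'_iff_mul_eq, ← map_mul, hc,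
    mul_comm]

/-- `z / y` is integral. -/
def D (y z : R) : Prop := ∃ w ∈ integralClosure R (FractionRing R),
  algebraMap R (FractionRing R) z = w * algebraMap R (FractionRing R) y

lemma D.refl (y : R) : D y y := ⟨1, one_mem _, by simp⟩

lemma D.trans {x y z : R} (h : D x y) (h' : D y z) : D x z := by
  obtain ⟨w, hw, e⟩ := h
  obtain ⟨w', hw', e'⟩ := h'
  exact ⟨w' * w, mul_mem hw' hw, by rw [e', e, mul_assoc]⟩

lemma D.add {y z z' : R} (h : D y z) (h' : D y z') : D y (z + z') := by
  obtain ⟨w, hw, e⟩ := h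
  obtain ⟨w', hw', e'⟩ := h'
  exact ⟨w + w', add_mem hw hw', by rw [map_add, e, e', add_mul]⟩

lemma D.mul {y y' z z' : R} (h : D y z) (h' : D y' z') : D (y * y') (z * z') := by
  obtain ⟨w, hw, e⟩ := h
  obtain ⟨w', hw', e'⟩ := h'
  exact ⟨w * w', mul_mem hw hw', by rw [map_mul, e, e', map_mul]; ring⟩

lemma D.smul {y z : R} (c : R) (h : D y z) : D y (c * z) := by
  obtain ⟨w, hw, e⟩ := h
  exact ⟨algebraMap _ _ c * w, mul_mem (Subalgebra.algebraMap_mem _ _) hw,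
    by rw [map_mul, e, mul_assoc]⟩

lemma D.span {y : R} {T : Set R} (h : ∀ z ∈ T, D y z) : ∀ z ∈ Ideal.span T, D y z := by
  intro z hz
  induction hz using Submodule.span_induction with
  | mem x hx => exact h x hx
  | zero => exact ⟨0, zero_mem _, by simp⟩
  | add x x' _ _ h h' => exact h.add h'
  | smul c x _ h => exact h.smul c

lemma D.pow {y : R} {I : Ideal R} (h : ∀ z ∈ I, D y z) (n : ℕ) :
    ∀ z ∈ I ^ n, D (y ^ n) z := by
  induction n with
  | zero => intro z _; exact ⟨algebraMap _ _ z, Subalgebra.algebraMap_mem _ _, by simp⟩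
  | succ n ih =>
    intro z hz
    rw [pow_succ] at hz ⊢
    refine Submodule.mul_induction_on hz (fun a ha b hb => (ih a ha).mul (h b hb))
      (fun a b ha hb => ha.add hb)

lemma D.idealIC {y : R} (hy : y ∈ nonZeroDivisors R) {I : Ideal R} (h : ∀ z ∈ I, D y z)
    {s : R} (hs : s ∈ LIC.idealIC I) : D y s := by
  obtain ⟨n, a, hn, ha, e⟩ := hs
  set f := algebraMap R (FractionRing R)
  have hyu : IsUnit (f y) := IsLocalization.map_units _ (⟨y, hy⟩ : nonZeroDivisors R)
  have key : ∀ j, ∃ w : integralClosure R (FractionRing R), 1 ≤ j → j ≤ n →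
      f (a j) = w * f y ^ j := by
    intro j
    by_cases hj : 1 ≤ j ∧ j ≤ n
    · obtain ⟨w, hw, e⟩ := D.pow h j _ (ha j hj.1 hj.2)
      exact ⟨⟨w, hw⟩, fun _ _ => by simpa using e⟩
    · exact ⟨0, fun h1 h2 => absurd ⟨h1, h2⟩ hj⟩
  choose b hb using key
  obtain ⟨w, hw⟩ : ∃ w, f s = w * f y := by
    obtain ⟨u, hu⟩ := hyu
    exact ⟨f s * ↑u⁻¹, by rw [← hu]; simp⟩
  refine ⟨w, ?_, hw⟩
  have : IsIntegral (integralClosure R (FractionRing R)) w := by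
    refine isIntegral_of_eq n b w ?_
    apply (hyu.pow n).mul_left_cancel
    rw [mul_zero, ← map_zero f, ← e, map_add, map_pow, hw, map_sum, mul_add, mul_pow,
      mul_comm (f y ^ n), Finset.mul_sum]
    congr 1
    refine Finset.sum_congr rfl fun j hj => ?_
    rw [Finset.mem_Icc] at hj
    rw [map_mul, map_pow, hw, hb j hj.1 hj.2]
    have : f y ^ n = f y ^ j * f y ^ (n - j) := by rw [← pow_add]; congr 1; omega
    rw [this, mul_pow]
    rw [show algebraMap (integralClosure R (FractionRing R)) (FractionRing R) (b j) = ↑(b j) from rfl]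
    ring
  exact isIntegral_trans (R := R) (A := integralClosure R (FractionRing R)) w this

end aux

section loc

variable {R : Type*} [CommRing R] [IsLocalRing R] [IsNoetherianRing R]

lemma length_ne_top_of_mem (hdim : ringKrullDim R = 1) {z : R} (hz : z ∈ nonZeroDivisors R)
    {I : Ideal R} (hzI : z ∈ I) : Module.length R (R ⧸ I) ≠ ⊤ := by
  have h1 : Ring.KrullDimLE 1 R := Ring.krullDimLE_iff.2 (by simp [hdim])
  rw [Ring.krullDimLE_one_iff] at h1
  have : Ring.KrullDimLE 0 (R ⧸ I) := by
    rw [Ring.krullDimLE_zero_iff]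
    intro P hP
    have hc : (P.comap (Ideal.Quotient.mk I)).IsPrime := inferInstance
    rcases h1 _ hc with h | h
    · exfalso
      refine Set.disjoint_left.1 (Ideal.disjoint_nonZeroDivisors_of_mem_minimalPrimes h) ?_ hz
      simp [Ideal.Quotient.eq_zero_iff_mem.2 hzI]
    · have := Ideal.map_eq_top_or_isMaximal_of_surjective (Ideal.Quotient.mk I)
        Ideal.Quotient.mk_surjective h
      rw [Ideal.map_comap_of_surjective _ Ideal.Quotient.mk_surjective] at this
      exact this.resolve_left hP.ne_top
  have : IsArtinianRing (R ⧸ I) := isArtinianRing_iff_krullDimLE_zero.2 this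
  rw [Module.length_eq_of_surjective (R := R ⧸ I) (S := R) (M := R ⧸ I)
    Ideal.Quotient.mk_surjective]
  exact Module.length_ne_top

/-- The number of minimal generators is bounded. -/
lemma bound (hdim : ringKrullDim R = 1) {x : R} (hx : x ∈ nonZeroDivisors R)
    (hxm : x ∈ maximalIdeal R) {J : Ideal R} {z : R} (hz : z ∈ nonZeroDivisors R)
    (hzJ : z ∈ J) {N : ℕ} (φ : J →ₗ[R] (Fin N → ResidueField R))
    (hφ : Function.Surjective φ) :
    (N : ℕ∞) ≤ Module.length R (R ⧸ Ideal.span {x}) := by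
  set K : Ideal R := Ideal.span {x} * J with hK
  have hKJ : K ≤ J := Ideal.mul_le_right
  have hKx : K ≤ Ideal.span {x} := Ideal.mul_le_left
  -- first exact sequence
  have e1 : Module.length R (R ⧸ K) =
      Module.length R (R ⧸ J) + Module.length R (R ⧸ Ideal.span {x}) := by
    refine Module.length_eq_add_of_exact
      (Submodule.mapQ J K (LinearMap.mulLeft R x) ?_) (Submodule.factor hKx) ?_ ?_ ?_
    · intro j hj
      exact Ideal.mem_span_singleton_mul.2 ⟨j, hj, rfl⟩
    · rw [← LinearMap.ker_eq_bot, LinearMap.ker_eq_bot']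
      intro m hm
      obtain ⟨r, rfl⟩ := Submodule.Quotient.mk_surjective _ m
      rw [Submodule.mapQ_apply, Submodule.Quotient.mk_eq_zero] at hm
      obtain ⟨j, hj, e⟩ := Ideal.mem_span_singleton_mul.1 hm
      rw [Submodule.Quotient.mk_eq_zero]
      have : j = r := (mul_cancel_left_mem_nonZeroDivisors hx).1 e
      exact this ▸ hj
    · exact Submodule.factor_surjective hKx
    · intro m
      obtain ⟨r, rfl⟩ := Submodule.Quotient.mk_surjective _ m
      constructor
      · intro h
        change Submodule.Quotient.mk r = 0 at h
        rw [Submodule.Quotient.mk_eq_zero] at h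
        obtain ⟨c, rfl⟩ := Ideal.mem_span_singleton.1 h
        exact ⟨Submodule.Quotient.mk c, rfl⟩
      · rintro ⟨c, hc⟩
        obtain ⟨c, rfl⟩ := Submodule.Quotient.mk_surjective _ c
        rw [← hc]
        change Submodule.Quotient.mk (x * c) = 0
        rw [Submodule.Quotient.mk_eq_zero]
        exact Ideal.mem_span_singleton.2 ⟨c, rfl⟩
  let P : Submodule R J := Submodule.comap J.subtype K
  have e2 : Module.length R (R ⧸ K) =
      Module.length R (J ⧸ P) + Module.length R (R ⧸ J) := by
    refine Module.length_eq_add_of_exact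
      (Submodule.mapQ P K J.subtype le_rfl) (Submodule.factor hKJ) ?_ ?_ ?_
    · rw [← LinearMap.ker_eq_bot, LinearMap.ker_eq_bot']
      intro m hm
      obtain ⟨r, rfl⟩ := Submodule.Quotient.mk_surjective _ m
      rw [Submodule.mapQ_apply, Submodule.Quotient.mk_eq_zero] at hm
      rw [Submodule.Quotient.mk_eq_zero]
      exact hm
    · exact Submodule.factor_surjective hKJ
    · intro m
      obtain ⟨r, rfl⟩ := Submodule.Quotient.mk_surjective _ m
      constructor
      · intro h
        change Submodule.Quotient.mk r = 0 at h
        rw [Submodule.Quotient.mk_eq_zero] at h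
        exact ⟨Submodule.Quotient.mk ⟨r, h⟩, rfl⟩
      · rintro ⟨c, hc⟩
        obtain ⟨c, rfl⟩ := Submodule.Quotient.mk_surjective _ c
        rw [← hc]
        change Submodule.Quotient.mk (c : R) = 0
        rw [Submodule.Quotient.mk_eq_zero]
        exact c.2
  have hP : P ≤ LinearMap.ker φ := by
    intro j hj
    obtain ⟨i, hi, e⟩ := Ideal.mem_span_singleton_mul.1 (show (j : R) ∈ K from hj)
    have : j = x • (⟨i, hi⟩ : J) := Subtype.ext e.symm
    rw [LinearMap.mem_ker, this, map_smul]
    ext k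
    rw [Pi.smul_apply, Algebra.smul_def, ResidueField.algebraMap_eq,
      (residue_eq_zero_iff x).2 hxm, zero_mul, Pi.zero_apply]
  have h3 : Module.length R (Fin N → ResidueField R) ≤ Module.length R (J ⧸ P) := by
    refine Module.length_le_of_surjective (P.liftQ φ hP) ?_
    intro y
    obtain ⟨j, rfl⟩ := hφ y
    exact ⟨Submodule.Quotient.mk j, rfl⟩
  have h4 : Module.length R (Fin N → ResidueField R) = N := by
    rw [Module.length_pi, Module.length_eq_of_surjective (R := ResidueField R) (S := R)
      (M := ResidueField R) residue_surjective]
    simp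
  rw [h4] at h3
  have hfin := length_ne_top_of_mem hdim hz hzJ
  rw [e1, add_comm] at e2
  have := (WithTop.add_right_inj hfin).1 e2
  rw [this]
  exact h3

lemma exists_relation (hdim : ringKrullDim R = 1) {x : R} (hx : x ∈ nonZeroDivisors R)
    (hxm : x ∈ maximalIdeal R) {a : R} (ha : a ∈ nonZeroDivisors R) (b : R) :
    ∃ (n : ℕ) (c : Fin (n + 1) → R), ∑ i, c i * (b ^ (i : ℕ) * a ^ (n - i)) = 0 ∧
      ∃ i, c i ∉ maximalIdeal R := by
  have hfin := length_ne_top_of_mem hdim hx (Ideal.mem_span_singleton_self x)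
  obtain ⟨n, hn⟩ := ENat.ne_top_iff_exists.1 hfin
  by_contra! hcon
  specialize hcon n
  let L : (Fin (n + 1) → R) →ₗ[R] R :=
    Fintype.linearCombination R (fun i : Fin (n + 1) => b ^ (i : ℕ) * a ^ (n - i))
  let J : Ideal R := LinearMap.range L
  let ψ : (Fin (n + 1) → R) →ₗ[R] (Fin (n + 1) → ResidueField R) :=
    LinearMap.pi fun i => (Algebra.linearMap R (ResidueField R)).comp (LinearMap.proj i)
  have hk : LinearMap.ker L ≤ LinearMap.ker ψ := by
    intro c hc
    rw [LinearMap.mem_ker] at hc ⊢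
    have := hcon c (by simpa [L, Fintype.linearCombination_apply] using hc)
    ext i
    exact (residue_eq_zero_iff _).2 (this i)
  let φ : J →ₗ[R] (Fin (n + 1) → ResidueField R) :=
    ((LinearMap.ker L).liftQ ψ hk).comp L.quotKerEquivRange.symm.toLinearMap
  have hφ : Function.Surjective φ := by
    intro y
    choose c hc using fun i => residue_surjective (y i)
    refine ⟨L.quotKerEquivRange (Submodule.Quotient.mk c), ?_⟩
    simp only [φ, LinearMap.comp_apply, LinearEquiv.coe_coe, LinearEquiv.symm_apply_apply]
    rw [Submodule.liftQ_apply]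
    ext i
    exact hc i
  have hz : a ^ n ∈ J := by
    refine ⟨Pi.single 0 1, ?_⟩
    simp [L]
  have := bound hdim hx hxm (pow_mem ha n) hz φ hφ
  rw [← hn] at this
  have : n + 1 ≤ n := by exact_mod_cast this
  omega

lemma pair (hdim : ringKrullDim R = 1) (hk : Infinite (ResidueField R))
    {x : R} (hx : x ∈ nonZeroDivisors R)
    (hxm : x ∈ maximalIdeal R) {a : R} (ha : a ∈ nonZeroDivisors R) (b : R) :
    ∃ y ∈ nonZeroDivisors R, y ∈ Ideal.span {a, b} ∧ D y a ∧ D y b := by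
  obtain ⟨n, c, hc, i0, hi0⟩ := exists_relation hdim hx hxm ha b
  set Q := FractionRing R
  have hau : IsUnit (algebraMap R Q a) :=
    IsLocalization.map_units _ (⟨a, ha⟩ : nonZeroDivisors R)
  obtain ⟨t, ht⟩ : ∃ t, algebraMap R Q b = t * algebraMap R Q a := by
    obtain ⟨u, hu⟩ := hau
    exact ⟨algebraMap R Q b * ↑u⁻¹, by rw [← hu]; simp⟩
  let f : R[X] := ∑ i : Fin (n + 1), C (c i) * X ^ (i : ℕ)
  have hft : aeval t f = 0 := by
    apply (hau.pow n).mul_left_cancel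
    rw [mul_zero, ← map_zero (algebraMap R Q), ← hc]
    simp only [f, map_sum, map_mul, aeval_C, map_pow, aeval_X]
    rw [Finset.mul_sum]
    refine Finset.sum_congr rfl fun i _ => ?_
    have : algebraMap R Q a ^ n = algebraMap R Q a ^ (i : ℕ) * algebraMap R Q a ^ (n - i) := by
      rw [← pow_add]; congr 1; omega
    rw [this, ht, mul_pow]
    ring
  have hfm : f.map (residue R) ≠ 0 := by
    intro h
    apply hi0
    have h1 := congrArg (fun p => p.coeff (i0 : ℕ)) h
    have h2 : f.coeff i0 = c i0 := by
      simp [f, coeff_X_pow, Fin.val_inj]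
    simp only [coeff_map, coeff_zero, h2] at h1
    exact (residue_eq_zero_iff _).1 h1
  obtain ⟨u0, hu0⟩ : ∃ u, (f.map (residue R)).eval u ≠ 0 := by
    by_contra! h
    exact hfm (Polynomial.funext fun u => by rw [h u, eval_zero])
  obtain ⟨u, rfl⟩ := residue_surjective u0
  have hunit : IsUnit (f.eval u) := by
    rw [eval_map_apply, residue_ne_zero_iff_isUnit] at hu0
    exact hu0
  let h := taylor u f
  have h0 : h.coeff 0 = f.eval u := taylor_coeff_zero _ _
  set v := t - algebraMap R Q u with hv
  have hhv : aeval v h = 0 := by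
    simp only [h, taylor_apply, aeval_comp, map_add, aeval_X, aeval_C, v, sub_add_cancel]
    exact hft
  have hvu : IsUnit v := by
    have e := hhv
    rw [← divX_mul_X_add h, map_add, map_mul, aeval_X, aeval_C, h0] at e
    have e2 : (-(aeval v h.divX)) * v = algebraMap R Q (f.eval u) := by
      linear_combination -e
    exact isUnit_of_mul_isUnit_right (e2 ▸ hunit.map (algebraMap R Q))
  have hy : algebraMap R Q (b - u * a) = v * algebraMap R Q a := by
    rw [map_sub, map_mul, ht, hv]; ring
  have hyn : b - u * a ∈ nonZeroDivisors R := by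
    have hu : IsUnit (algebraMap R Q (b - u * a)) := hy ▸ hvu.mul hau
    rw [mem_nonZeroDivisors_iff_right]
    intro r hr
    apply IsFractionRing.injective R Q
    rw [map_zero]
    apply hu.mul_right_cancel
    rw [← map_mul, hr, map_zero, zero_mul]
  have hya : D (b - u * a) a := by
    let := hvu.invertible
    refine ⟨⅟v, ?_, by rw [hy, invOf_mul_cancel_left]⟩
    have hrev : eval₂ (algebraMap R Q) (⅟v) h.reverse = 0 := by
      rw [eval₂_reverse_eq_zero_iff]; exact hhv
    have hlead : h.reverse.leadingCoeff = f.eval u := by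
      rw [reverse_leadingCoeff, ← h0, trailingCoeff, natTrailingDegree_eq_zero.2 (Or.inr ?_)]
      rw [h0]; exact hunit.ne_zero
    obtain ⟨w, hw⟩ := hunit
    refine ⟨C (↑w⁻¹ : R) * h.reverse, ?_, ?_⟩
    · apply monic_C_mul_of_mul_leadingCoeff_eq_one
      rw [hlead, ← hw]; simp
    · rw [eval₂_mul, hrev, mul_zero]
  refine ⟨b - u * a, hyn, ?_, hya, ?_⟩
  · exact sub_mem (Ideal.subset_span (by simp))
      (Ideal.mul_mem_left _ _ (Ideal.subset_span (by simp)))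
  · have := (D.refl (b - u * a)).add (hya.smul u)
    rwa [sub_add_cancel] at this

lemma exists_reduction (hdim : ringKrullDim R = 1) (hk : Infinite (ResidueField R))
    {x : R} (hx : x ∈ nonZeroDivisors R)
    (hxm : x ∈ maximalIdeal R) {I : Ideal R} {a : R} (ha : a ∈ nonZeroDivisors R)
    (haI : a ∈ I) : ∃ y ∈ nonZeroDivisors R, y ∈ I ∧ ∀ z ∈ I, D y z := by
  classical
  obtain ⟨T, hT⟩ := (isNoetherianRing_iff_ideal_fg R).1 inferInstance I
  have key : ∀ T : Finset R, (∀ t ∈ T, t ∈ I) →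
      ∃ y ∈ nonZeroDivisors R, y ∈ I ∧ ∀ z ∈ T, D y z := by
    intro T
    induction T using Finset.induction_on with
    | empty => intro _; exact ⟨a, ha, haI, by simp⟩
    | insert b T _ ih =>
      intro hT
      obtain ⟨y, hy, hyI, h⟩ := ih fun t ht => hT t (Finset.mem_insert_of_mem ht)
      obtain ⟨y', hy', hyI', h1, h2⟩ := pair hdim hk hx hxm hy b
      refine ⟨y', hy', ?_, ?_⟩
      · refine (Ideal.span_le.2 ?_) hyI'
        rintro z (rfl | rfl)
        · exact hyI
        · exact hT _ (Finset.mem_insert_self _ _)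
      · intro z hz
        rcases Finset.mem_insert.1 hz with rfl | hz
        · exact h2
        · exact h1.trans (h z hz)
  obtain ⟨y, hy, hyI, h⟩ := key T fun t ht => hT ▸ Ideal.subset_span ht
  exact ⟨y, hy, hyI, by rw [← hT]; exact D.span h⟩

lemma conductor_le_tau (hdim : ringKrullDim R = 1) (hk : Infinite (ResidueField R))
    {x : R} (hx : x ∈ nonZeroDivisors R) (hxm : x ∈ maximalIdeal R) :
    conductor R ≤ ⨅ I : Ideal R, colonIdeal I (idealIC I) := by
  intro r hr
  rw [Submodule.mem_iInf]
  intro I s hs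
  have step : ∀ n : ℕ, r * s ∈ I ⊔ maximalIdeal R ^ n := by
    intro n
    have hs' : s ∈ idealIC (I ⊔ maximalIdeal R ^ n) := by
      obtain ⟨k, a, hk, ha, e⟩ := hs
      exact ⟨k, a, hk, fun j h1 h2 => Ideal.pow_right_mono le_sup_left j (ha j h1 h2), e⟩
    obtain ⟨y, hy, hyI, h⟩ := exists_reduction hdim hk hx hxm (pow_mem hx n)
      (Ideal.mem_sup_right (Ideal.pow_mem_pow hxm n) : x ^ n ∈ I ⊔ maximalIdeal R ^ n)
    obtain ⟨w, hw, e⟩ := D.idealIC hy h hs'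
    obtain ⟨c, hc⟩ := hr w hw
    have : r * s = c * y := by
      apply IsFractionRing.injective R (FractionRing R)
      rw [map_mul, map_mul, e, hc, mul_assoc]
    rw [this]
    exact Ideal.mul_mem_left _ _ hyI
  have hkr := Ideal.iInf_pow_smul_eq_bot_of_isLocalRing (M := R ⧸ I) (maximalIdeal R)
    (Ideal.IsPrime.ne_top inferInstance)
  have : Submodule.Quotient.mk (r * s) ∈
      (⨅ i : ℕ, maximalIdeal R ^ i • ⊤ : Submodule R (R ⧸ I)) := by
    rw [Submodule.mem_iInf]
    intro n
    obtain ⟨i, hi, j, hj, e⟩ := Submodule.mem_sup.1 (step n)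
    have h1 : (Submodule.Quotient.mk (r * s) : R ⧸ I) = j • Submodule.Quotient.mk 1 := by
      rw [← Submodule.Quotient.mk_smul, Submodule.Quotient.eq, ← e]
      simpa using hi
    rw [h1]
    exact Submodule.smul_mem_smul hj trivial
  rw [hkr, Submodule.mem_bot, Submodule.Quotient.mk_eq_zero] at this
  exact this

lemma cm_iff (hdim : ringKrullDim R = 1) : IsCohenMacaulayLocalRing R ↔
    ∃ x ∈ nonZeroDivisors R, x ∈ maximalIdeal R := by
  constructor
  · rintro ⟨rs, hm, hreg, hl⟩
    rw [hdim] at hl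
    have hl : rs.length = 1 := by exact_mod_cast hl
    obtain ⟨x, rfl⟩ := List.length_eq_one_iff.1 hl
    refine ⟨x, ?_, hm x (by simp)⟩
    have := (RingTheory.Sequence.isWeaklyRegular_singleton_iff R x).1 hreg.toIsWeaklyRegular
    rw [mem_nonZeroDivisors_iff_right]
    intro r hr
    apply this
    simpa [mul_comm] using hr
  · rintro ⟨x, hx, hxm⟩
    refine ⟨[x], by simpa using hxm, ⟨?_, ?_⟩, by simp [hdim]⟩
    · rw [RingTheory.Sequence.isWeaklyRegular_singleton_iff]
      intro a b hab
      exact (mul_cancel_left_mem_nonZeroDivisors hx).1 hab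
    · rw [Ideal.ofList_singleton]
      intro h
      have h2 : (1 : R) ∈ (Ideal.span {x} • ⊤ : Submodule R R) := h ▸ trivial
      have h3 : (1 : R) ∈ maximalIdeal R := by
        have : (Ideal.span {x} • ⊤ : Submodule R R) ≤ maximalIdeal R :=
          Ideal.mul_le_left.trans ((Ideal.span_singleton_le_iff_mem _).2 hxm)
        exact this h2
      exact (Ideal.ne_top_iff_one _).1 (Ideal.IsPrime.ne_top inferInstance) h3

lemma not_cm (hdim : ringKrullDim R = 1) (h : ¬ IsCohenMacaulayLocalRing R) :
    conductor R = ⊤ ∧ (⨅ I : Ideal R, colonIdeal I (idealIC I)) ≠ ⊤ := by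
  rw [cm_iff hdim] at h
  push Not at h
  constructor
  · rw [Ideal.eq_top_iff_one]
    intro y _
    obtain ⟨a, b, rfl⟩ := IsLocalization.exists_mk'_eq (nonZeroDivisors R) y
    have hb : IsUnit (b : R) := by
      by_contra hb
      exact h b b.2 ((mem_maximalIdeal _).2 hb)
    obtain ⟨u, hu⟩ := hb
    refine ⟨a * ↑u⁻¹, ?_⟩
    rw [map_one, one_mul, IsLocalization.eq_mk'_iff_mul_eq, ← map_mul, ← hu]
    simp
  · intro htop
    have hsub : (maximalIdeal R : Set R) ⊆ ⋃ p ∈ associatedPrimes R R, (p : Set R) := by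
      rw [biUnion_associatedPrimes_eq_compl_nonZeroDivisors]
      intro x hx hx'
      exact h x hx' hx
    obtain ⟨p, hp, hle⟩ := (Ideal.subset_union_prime_finite (associatedPrimes.finite R R)
      (f := id) ⊥ ⊥ (fun i hi _ _ => hi.1)).1 hsub
    obtain ⟨hpp, x, hpx⟩ := isAssociatedPrime_iff.1 hp
    have hx0 : ∀ y ∈ maximalIdeal R, y * x = 0 := by
      intro y hy
      have := hle hy
      simp only [id] at this
      rw [hpx] at this
      simpa using this
    have hxne : x ≠ 0 := by
      rintro rfl
      apply hpp.ne_top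
      rw [hpx]
      simp
    have hxm : x ∈ maximalIdeal R := by
      by_contra hxm
      have hxu : IsUnit x := by simpa using hxm
      have hm : maximalIdeal R = ⊥ := by
        rw [eq_bot_iff]
        intro y hy
        exact hxu.mul_left_eq_zero.1 (hx0 y hy)
      have := isField_iff_maximalIdeal_eq.2 hm
      rw [ringKrullDim_eq_zero_of_isField this] at hdim
      exact zero_ne_one hdim
    have h1 : (1 : R) ∈ ⨅ I : Ideal R, colonIdeal I (idealIC I) := htop ▸ trivial
    have := (Submodule.mem_iInf _).1 h1 ⊥ x ⟨2, 0, by simp, by simp, by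
      simp [pow_two, hx0 x hxm]⟩
    exact hxne (by simpa using this)

end loc

end LIC

/-- Let `(R,m)` be a Noetherian local ring of Krull dimension one with
infinite residue field, and `τ_I := ⋂_I (I :_R Ī)`.  Then `R` is Cohen–Macaulay iff
`τ_I` equals the conductor `c_R = (R :_R R̄)`; and if `R` is not Cohen–Macaulay, then
`c_R = R` while `τ_I` is a proper ideal. -/
theorem dim_one_tau_I_eq_conductor (R : Type*) [CommRing R] [IsLocalRing R]
    [IsNoetherianRing R] (hdim : ringKrullDim R = 1)
    (hk : Infinite (IsLocalRing.ResidueField R)) :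
    (LIC.IsCohenMacaulayLocalRing R ↔
      (⨅ I : Ideal R, LIC.colonIdeal I (LIC.idealIC I)) = LIC.conductor R) ∧
    (¬ LIC.IsCohenMacaulayLocalRing R →
      LIC.conductor R = ⊤ ∧ (⨅ I : Ideal R, LIC.colonIdeal I (LIC.idealIC I)) ≠ ⊤) := by

  refine ⟨⟨fun h => ?_, fun h => ?_⟩, LIC.not_cm hdim⟩
  · obtain ⟨x, hx, hxm⟩ := (LIC.cm_iff hdim).1 h
    exact le_antisymm LIC.tau_le_conductor (LIC.conductor_le_tau hdim hk hx hxm)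
  · by_contra hc
    obtain ⟨h1, h2⟩ := LIC.not_cm hdim hc
    exact h2 (h.trans h1)
end

section
/- Let (R,m) be a Noetherian local ring that is either excellent or a homomorphic image of a Gorenstein local ring. Suppose dim R ≥ 2 and R is equidimensional with no embedded primes. Then τ_M = τ_I = 0, i.e., the intersection over all ideals I of R of (I :_R Ī) is zero, and the intersection over all finitely generated R-modules M of ann_R lic(0,M) is zero. -/
namespace LIC

open scoped TensorProduct

/-- A regular local ring: a Noetherian local ring whose maximal ideal can be generated by
`dim R` elements. -/
def IsRegularLocalRing (A : Type*) [CommRing A] : Prop :=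
  IsNoetherianRing A ∧ ∃ _ : IsLocalRing A, ∃ s : Finset A,
    Ideal.span (s : Set A) = IsLocalRing.maximalIdeal A ∧
    (s.card : WithBot ℕ∞) = ringKrullDim A

/-- A regular ring: all localizations at primes are regular local rings. -/
def IsRegularRing (A : Type*) [CommRing A] : Prop :=
  ∀ (q : Ideal A) (_ : q.IsPrime), IsRegularLocalRing (Localization.AtPrime q)

universe v

/-- An `R`-algebra `S` has geometrically regular fibers if for every prime `p ⊆ R` and
every finite field extension `K` of the residue field `κ(p) = Frac(R/p)`, the
base-changed fiber `K ⊗_R S` is a regular ring. -/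
def HasGeometricallyRegularFibers (R : Type*) (S : Type*) [CommRing R] [CommRing S]
    [Algebra R S] : Prop :=
  ∀ (p : Ideal R) (_ : p.IsPrime)
    (K : Type v) (_ : Field K) (_ : Algebra (R ⧸ p) K) (_ : NoZeroSMulDivisors (R ⧸ p) K)
    (_ : Algebra R K) (_ : IsScalarTower R (R ⧸ p) K),
    (letI := FractionRing.liftAlgebra (R ⧸ p) K
     FiniteDimensional (FractionRing (R ⧸ p)) K) →
    IsRegularRing (K ⊗[R] S)

/-- A catenary ring: any two saturated chains of primes with the same endpoints have the
same length. -/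
def IsCatenaryRing (A : Type*) [CommRing A] : Prop :=
  ∀ c d : LTSeries (PrimeSpectrum A),
    c.head = d.head → c.last = d.last →
    (∀ i : Fin c.length, c.toFun i.castSucc ⋖ c.toFun i.succ) →
    (∀ i : Fin d.length, d.toFun i.castSucc ⋖ d.toFun i.succ) →
    c.length = d.length

universe u

/-- A G-ring: for every prime `p`, the formal fibers of `R_p` (the fibers of the map from
`R_p` to its maximal-adic completion) are geometrically regular. -/
def IsGRing (R : Type u) [CommRing R] : Prop :=
  ∀ (p : Ideal R) (_ : p.IsPrime),
    HasGeometricallyRegularFibers.{u} (Localization.AtPrime p)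
      (AdicCompletion (IsLocalRing.maximalIdeal (Localization.AtPrime p))
        (Localization.AtPrime p))

/-- J-2: for every finite-type `R`-algebra, the regular locus of its prime spectrum is
open. -/
def IsJ2 (R : Type u) [CommRing R] : Prop :=
  ∀ (A : Type u) (_ : CommRing A) (_ : Algebra R A), Algebra.FiniteType R A →
    IsOpen {q : PrimeSpectrum A | IsRegularLocalRing (Localization.AtPrime q.asIdeal)}

/-- Universally catenary: every finite-type `R`-algebra is catenary. -/
def IsUniversallyCatenary (R : Type u) [CommRing R] : Prop :=
  ∀ (A : Type u) (_ : CommRing A) (_ : Algebra R A), Algebra.FiniteType R A →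
    IsCatenaryRing A

/-- An excellent ring: a universally catenary Noetherian G-ring satisfying J-2. -/
def IsExcellentRing (R : Type u) [CommRing R] : Prop :=
  IsNoetherianRing R ∧ IsUniversallyCatenary R ∧ IsGRing R ∧ IsJ2 R

open CategoryTheory in
/-- A Gorenstein local ring: a Noetherian local ring having finite injective dimension
over itself, i.e. admitting a finite-length injective resolution of itself. -/
def IsGorensteinLocalRing (S : Type u) [CommRing S] : Prop :=
  IsNoetherianRing S ∧ IsLocalRing S ∧
  ∃ (I : InjectiveResolution (ModuleCat.of S S)) (n : ℕ),
    ∀ m, n ≤ m → Limits.IsZero (I.cocomplex.X m)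

/-- A local ring is equidimensional if `dim (R/p) = dim R` for every minimal prime `p`. -/
def IsEquidimensionalRing (R : Type*) [CommRing R] : Prop :=
  ∀ p ∈ minimalPrimes R, ringKrullDim (R ⧸ p) = ringKrullDim R

/-- A ring has no embedded primes if every associated prime (of `R` as a module over
itself) is a minimal prime. -/
def HasNoEmbeddedPrimes (R : Type*) [CommRing R] : Prop :=
  ∀ p : Ideal R, IsAssociatedPrime p R → p ∈ minimalPrimes R

end LIC

section
open Polynomial
namespace LIC

lemma core_filter {A : Type*} [CommRing A] [IsNoetherianRing A] (n M : Ideal A) [n.IsPrime]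
    [M.IsPrime] (hmin : ∀ q : Ideal A, q.IsPrime → q ≤ n → q = n) (x y : A) (hx : x ∉ n)
    (H : ∀ (k l : ℕ) (a b : A), y ^ l * a - x ^ k * b ∈ n →
      ∃ s ∉ M, ∃ b', s * a - x ^ k * b' ∈ n)
    (N : Type*) [AddCommGroup N] [Module A N] (hN : Module.Finite A N) :
    ∃ e ∉ n, (∀ (k : ℕ) (m : N), x ^ k • m = 0 → e • m = 0) ∧
      ∀ (k l : ℕ) (m w : N), y ^ l • m = x ^ k • w → ∃ s ∉ M, ∃ v : N, (e * s) • m = x ^ k • v := by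
  induction hN using IsNoetherianRing.induction_on_isQuotientEquivQuotientPrime A with
  | subsingleton N =>
    refine ⟨1, ?_, fun k m _ => Subsingleton.elim _ _, fun k l m w _ => ⟨1, ?_, 0, Subsingleton.elim _ _⟩⟩
    · exact fun h => (inferInstance : n.IsPrime).ne_top ((Ideal.eq_top_iff_one _).2 h)
    · exact fun h => (inferInstance : M.IsPrime).ne_top ((Ideal.eq_top_iff_one _).2 h)
  | quotient N q f =>
    by_cases hq : q.1 ≤ n
    · have hqn := hmin _ q.2 hq
      refine ⟨1, ?_, ?_, ?_⟩
      · exact fun h => (inferInstance : n.IsPrime).ne_top ((Ideal.eq_top_iff_one _).2 h)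
      · intro k m hm
        obtain ⟨a, ha⟩ := Ideal.Quotient.mk_surjective (f m)
        have h1 : f (x ^ k • m) = Ideal.Quotient.mk q.1 (x ^ k * a) := by
          rw [map_smul, ← ha]; rfl
        rw [hm, map_zero, eq_comm, Ideal.Quotient.eq_zero_iff_mem, hqn] at h1
        have h2 : a ∈ n := ((inferInstance : n.IsPrime).mem_or_mem h1).resolve_left
          (fun h => hx ((inferInstance : n.IsPrime).mem_of_pow_mem _ h))
        rw [← hqn, ← Ideal.Quotient.eq_zero_iff_mem, ha] at h2
        rw [one_smul]
        exact f.injective (by rw [h2, map_zero])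
      · intro k l m w hm
        obtain ⟨a, ha⟩ := Ideal.Quotient.mk_surjective (f m)
        obtain ⟨b, hb⟩ := Ideal.Quotient.mk_surjective (f w)
        have h1 : f (y ^ l • m) = Ideal.Quotient.mk q.1 (y ^ l * a) := by
          rw [map_smul, ← ha]; rfl
        have h2 : f (x ^ k • w) = Ideal.Quotient.mk q.1 (x ^ k * b) := by
          rw [map_smul, ← hb]; rfl
        rw [hm, h2, eq_comm, Ideal.Quotient.eq, hqn] at h1
        obtain ⟨s, hs, b', hb'⟩ := H k l a b h1
        refine ⟨s, hs, f.symm (Ideal.Quotient.mk q.1 b'), f.injective ?_⟩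
        rw [map_smul, map_smul, f.apply_symm_apply, ← ha, one_mul]
        change Ideal.Quotient.mk q.1 (s * a) = Ideal.Quotient.mk q.1 (x ^ k * b')
        rw [Ideal.Quotient.eq, hqn]; exact hb'
    · obtain ⟨e, heq, hen⟩ := Set.not_subset.1 hq
      have hk : ∀ m : N, e • m = 0 := by
        intro m
        apply f.injective
        obtain ⟨a, ha⟩ := Ideal.Quotient.mk_surjective (f m)
        rw [map_smul, map_zero, ← ha]
        change Ideal.Quotient.mk q.1 (e * a) = 0
        rw [Ideal.Quotient.eq_zero_iff_mem]
        exact Ideal.mul_mem_right _ _ heq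
      refine ⟨e, hen, fun k m _ => hk m, fun k l m w _ => ⟨1, ?_, 0, by simp [hk]⟩⟩
      exact fun h => (inferInstance : M.IsPrime).ne_top ((Ideal.eq_top_iff_one _).2 h)
  | exact N₁ N₂ N₃ f g hf hg hfg h₁ h₃ =>
    obtain ⟨e₁, he₁, hQ₁, hP₁⟩ := h₁
    obtain ⟨e₃, he₃, hQ₃, hP₃⟩ := h₃
    have hp : n.IsPrime := inferInstance
    have hpM : M.IsPrime := inferInstance
    refine ⟨e₁ * e₃ * e₃, ?_, ?_, ?_⟩
    · exact hp.mul_notMem (hp.mul_notMem he₁ he₃) he₃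
    · intro k m hm
      have h1 := hQ₃ k (g m) (by rw [← map_smul, hm, map_zero])
      rw [← map_smul] at h1
      obtain ⟨m', hm'⟩ := (hfg _).1 h1
      have h2 := hQ₁ k m' (hf (by rw [map_smul, hm', map_zero, smul_comm, hm, smul_zero]))
      have h3 : e₁ • e₃ • m = 0 := by rw [← hm', ← map_smul, h2, map_zero]
      rw [mul_right_comm, mul_smul, smul_comm] at *
      rw [mul_comm, mul_smul, h3, smul_zero]
    · intro k l m w hm
      obtain ⟨s, hs, v'', hv''⟩ := hP₃ k l (g m) (g w) (by rw [← map_smul, hm, map_smul])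
      obtain ⟨v, rfl⟩ := hg v''
      have h1 : g ((e₃ * s) • m - x ^ k • v) = 0 := by
        rw [map_sub, map_smul, map_smul, hv'', sub_self]
      obtain ⟨m', hm'⟩ := (hfg _).1 h1
      have h2 : y ^ l • f m' = x ^ k • ((e₃ * s) • w - y ^ l • v) := by
        rw [hm', smul_sub, smul_sub, smul_comm (y ^ l) (e₃ * s), hm, smul_comm (y ^ l) (x ^ k),
          smul_comm (x ^ k) (e₃ * s)]
      have h3 := hQ₃ k (g ((e₃ * s) • w - y ^ l • v)) (by
        rw [← map_smul, ← h2, map_smul, hfg.apply_apply_eq_zero, smul_zero])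
      rw [← map_smul] at h3
      obtain ⟨w', hw'⟩ := (hfg _).1 h3
      obtain ⟨s', hs', v', hv'⟩ := hP₁ k l (e₃ • m') w' (hf (by
        rw [map_smul, map_smul, map_smul, hw', smul_comm, h2, smul_comm]))
      refine ⟨s * s', hpM.mul_notMem hs hs', f v' + (e₁ * e₃ * s') • v, ?_⟩
      have h4 := congrArg f hv'
      rw [map_smul, map_smul, hm', map_smul] at h4
      rw [smul_add, ← h4]
      module

lemma core_krull {A : Type*} [CommRing A] [IsNoetherianRing A] (n M : Ideal A) [n.IsPrime]
    [M.IsPrime] (hnM : n ≤ M)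
    (hmin : ∀ q : Ideal A, q.IsPrime → q ≤ n → q = n) (x y : A) (hx : x ∉ n)
    (hxM : x ∈ M) (hyM : y ∈ M)
    (H : ∀ (k l : ℕ) (a b : A), y ^ l * a - x ^ k * b ∈ n →
      ∃ s ∉ M, ∃ b', s * a - x ^ k * b' ∈ n)
    (c : A) (hc : ∀ i : ℕ, 0 < i → ∃ α β, c * (x ^ i * y ^ i) = α * x ^ (2 * i) + β * y ^ (2 * i)) :
    ∃ e ∉ n, e * c = 0 := by
  have hp : n.IsPrime := inferInstance
  have hpM : M.IsPrime := inferInstance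
  obtain ⟨e, he, hQ, hP⟩ := core_filter n M hmin x y hx H A inferInstance
  simp only [smul_eq_mul] at hQ hP
  have key : ∀ i : ℕ, 0 < i → ∃ t ∉ M, t * (e ^ 3 * c) ∈ M ^ i := by
    intro i hi
    obtain ⟨α, β, h⟩ := hc i hi
    obtain ⟨s, hs, β', h1⟩ := hP i (2 * i) β (c * y ^ i - α * x ^ i) (by
      have : x ^ (2 * i) = x ^ i * x ^ i := by rw [two_mul, pow_add]
      rw [this] at h
      linear_combination -h)
    have h2 := hQ i (e * s * c * y ^ i - e * s * α * x ^ i - β' * y ^ (2 * i)) (by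
      have : x ^ (2 * i) = x ^ i * x ^ i := by rw [two_mul, pow_add]
      rw [this] at h
      linear_combination e * s * h + y ^ (2 * i) * h1)
    obtain ⟨s', hs', v, h3⟩ := hP i i (e ^ 2 * s * c - e * β' * y ^ i) (e ^ 2 * s * α) (by
      have : y ^ (2 * i) = y ^ i * y ^ i := by rw [two_mul, pow_add]
      rw [this] at h2
      linear_combination h2)
    refine ⟨s * s', hpM.mul_notMem hs hs', ?_⟩
    have : s * s' * (e ^ 3 * c) = v * x ^ i + (e * s' * (e * β')) * y ^ i := by
      linear_combination h3
    rw [this]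
    exact add_mem (Ideal.mul_mem_left _ _ (Ideal.pow_mem_pow hxM i))
      (Ideal.mul_mem_left _ _ (Ideal.pow_mem_pow hyM i))
  have h0 : algebraMap A (Localization.AtPrime M) (e ^ 3 * c) = 0 := by
    have : IsNoetherianRing (Localization.AtPrime M) :=
      IsLocalization.isNoetherianRing M.primeCompl _ inferInstance
    rw [← Ideal.mem_bot, ← Ideal.iInf_pow_eq_bot_of_isLocalRing
      (IsLocalRing.maximalIdeal (Localization.AtPrime M)) (Ideal.IsPrime.ne_top'), Ideal.mem_iInf]
    intro i
    rcases Nat.eq_zero_or_pos i with rfl | hi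
    · simp
    obtain ⟨t, ht, h⟩ := key i hi
    have h5 := Ideal.mem_map_of_mem (algebraMap A (Localization.AtPrime M)) h
    rw [Ideal.map_pow, Localization.AtPrime.map_eq_maximalIdeal, map_mul] at h5
    exact (Ideal.unit_mul_mem_iff_mem _
      (IsLocalization.map_units (Localization.AtPrime M) (⟨t, ht⟩ : M.primeCompl))).1 h5
  rw [IsLocalization.map_eq_zero_iff M.primeCompl] at h0
  obtain ⟨t, ht⟩ := h0
  refine ⟨t * e ^ 3, hp.mul_notMem (fun h => t.2 (hnM h)) (fun h => he (hp.mem_of_pow_mem _ h)), ?_⟩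
  rw [mul_assoc, ht]

lemma principal_of_div {L : Type*} [CommRing L] [IsDomain L] [IsNoetherianRing L] [IsLocalRing L]
    [IsIntegrallyClosed L] (z u : L) (hz' : z ≠ 0)
    (hdiv : ∀ a ∈ IsLocalRing.maximalIdeal L, z ∣ a * u) (hnd : ¬ z ∣ u) :
    (IsLocalRing.maximalIdeal L).IsPrincipal := by
  by_cases hcase : ∃ a ∈ IsLocalRing.maximalIdeal L, ∃ v, IsUnit v ∧ a * u = z * v
  · obtain ⟨a, ha, v, hv, hav⟩ := hcase
    refine ⟨a, le_antisymm (fun b hb => ?_) ?_⟩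
    · obtain ⟨r, hr⟩ := hdiv b hb
      have h1 : v * b = r * a := by
        apply mul_left_cancel₀ hz'
        linear_combination -b * hav + a * hr
      obtain ⟨w, rfl⟩ := hv
      change b ∈ Ideal.span {a}
      rw [Ideal.mem_span_singleton']
      exact ⟨↑w⁻¹ * r, by rw [mul_assoc, ← h1, Units.inv_mul_cancel_left]⟩
    · change Ideal.span {a} ≤ _
      rwa [Ideal.span_le, Set.singleton_subset_iff]
  · exfalso
    push Not at hcase
    let K := FractionRing L
    let w : K := algebraMap L K u / algebraMap L K z
    have hzK : algebraMap L K z ≠ 0 := IsFractionRing.to_map_eq_zero_iff.not.mpr hz'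
    by_cases hbot : IsLocalRing.maximalIdeal L = ⊥
    · have hf : IsField L := IsLocalRing.isField_iff_maximalIdeal_eq.2 hbot
      obtain ⟨b, hb⟩ := hf.mul_inv_cancel hz'
      exact hnd ⟨b * u, by rw [← mul_assoc, hb, one_mul]⟩
    let N := Submodule.map (Algebra.linearMap L K) (IsLocalRing.maximalIdeal L)
    have hint : IsIntegral L w := by
      refine isIntegral_of_smul_mem_submodule N ?_ ?_ w ?_
      · obtain ⟨a, ha, ha0⟩ := Submodule.exists_mem_ne_zero_of_ne_bot hbot
        rw [Submodule.ne_bot_iff]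
        exact ⟨_, ⟨a, ha, rfl⟩, (IsFractionRing.to_map_eq_zero_iff (K := K)).not.mpr ha0⟩
      · exact Submodule.FG.map _ (IsNoetherian.noetherian _)
      · rintro _ ⟨a, ha, rfl⟩
        obtain ⟨r, hr⟩ := hdiv a ha
        refine ⟨r, ?_, ?_⟩
        · change r ∈ IsLocalRing.maximalIdeal L
          rw [IsLocalRing.mem_maximalIdeal]
          exact fun hu => hcase a ha r hu hr
        · change algebraMap L K r = w * algebraMap L K a
          have := congrArg (algebraMap L K) hr
          rw [map_mul, map_mul] at this
          simp only [w]
          rw [div_mul_eq_mul_div, eq_div_iff hzK]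
          linear_combination -this
    obtain ⟨r, hr⟩ := IsIntegrallyClosed.algebraMap_eq_of_integral hint
    apply hnd
    refine ⟨r, IsFractionRing.injective L K ?_⟩
    rw [map_mul, hr]
    simp only [w]
    rw [mul_comm, div_mul_cancel₀ _ hzK]

/-- An associated prime of a principal ideal in a normal domain has height at most one. -/
lemma height_le_one_of_assoc {T : Type*} [CommRing T] [IsDomain T] [IsNoetherianRing T]
    [IsIntegrallyClosed T] (Q : Ideal T) [Q.IsPrime] (z u : T) (hz : z ≠ 0)
    (hQ : ∀ a, a ∈ Q ↔ z ∣ a * u) : Q.height ≤ 1 := by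
  let L := Localization.AtPrime Q
  have hnoeth : IsNoetherianRing L := IsLocalization.isNoetherianRing Q.primeCompl _ inferInstance
  have hic : IsIntegrallyClosed L :=
    isIntegrallyClosed_of_isLocalization L Q.primeCompl Q.primeCompl_le_nonZeroDivisors
  have hdom : IsDomain L := IsLocalization.isDomain_localization Q.primeCompl_le_nonZeroDivisors
  let φ := algebraMap T L
  have hφ : Function.Injective φ := IsLocalization.injective L Q.primeCompl_le_nonZeroDivisors
  have hz' : φ z ≠ 0 := fun h => hz (hφ (by rw [h, map_zero]))
  have hdiv : ∀ a ∈ IsLocalRing.maximalIdeal L, φ z ∣ a * φ u := by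
    intro a ha
    obtain ⟨b, s, rfl⟩ := IsLocalization.exists_mk'_eq Q.primeCompl a
    have hb : b ∈ Q := (IsLocalization.AtPrime.mk'_mem_maximal_iff L Q b s).1 ha
    obtain ⟨r, hr⟩ := (hQ b).1 hb
    refine ⟨IsLocalization.mk' L r s, ?_⟩
    rw [mul_comm, IsLocalization.mul_mk'_eq_mk'_of_mul, IsLocalization.mul_mk'_eq_mk'_of_mul,
      mul_comm u b, hr]
  have hnd : ¬ φ z ∣ φ u := by
    rintro ⟨a, ha⟩
    obtain ⟨b, s, rfl⟩ := IsLocalization.exists_mk'_eq Q.primeCompl a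
    rw [IsLocalization.mul_mk'_eq_mk'_of_mul, eq_comm, IsLocalization.mk'_eq_iff_eq_mul,
      ← map_mul] at ha
    have := hφ ha
    exact s.2 ((hQ s).2 ⟨b, by rw [mul_comm, ← this]⟩)
  have hprin := principal_of_div (φ z) (φ u) hz' hdiv hnd
  have h1 : (IsLocalRing.maximalIdeal L).height ≤ 1 :=
    Ideal.height_le_one_of_isPrincipal_of_mem_minimalPrimes (IsLocalRing.maximalIdeal L) _
      (by rw [Ideal.minimalPrimes_eq_subsingleton_self]; rfl)
  rwa [← IsLocalization.height_under Q.primeCompl,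
      Localization.AtPrime.under_maximalIdeal] at h1

end LIC

namespace LIC

lemma core_normal {R T : Type*} [CommRing R] [CommRing T] [IsDomain T] [IsNoetherianRing T]
    [IsIntegrallyClosed T] [Algebra R T] [Algebra.IsIntegral R T] (M Q₀ : Ideal T) [M.IsPrime]
    [Q₀.IsPrime] (hlt : Q₀ < M) (x : R) (hxQ : algebraMap R T x ∈ Q₀) (hx0 : algebraMap R T x ≠ 0) :
    ∃ y : R, algebraMap R T y ∈ M ∧ ∀ (k l : ℕ) (t b : T),
      algebraMap R T y ^ l * t = algebraMap R T x ^ k * b →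
      ∃ s ∉ M, ∃ b', s * t = algebraMap R T x ^ k * b' := by
  set X := algebraMap R T x with hX
  have hfin : {q | q ∈ (Ideal.span {X}).minimalPrimes ∧ q ≤ M}.Finite :=
    ((Ideal.span {X}).finite_minimalPrimes_of_isNoetherianRing T).subset fun q hq => hq.1
  have hex : ∃ y ∈ M.comap (algebraMap R T), ∀ q ∈ (Ideal.span {X}).minimalPrimes, q ≤ M →
      algebraMap R T y ∉ q := by
    by_contra! hcon
    have hsub : ((M.comap (algebraMap R T) : Ideal R) : Set R) ⊆
        ⋃ q ∈ {q | q ∈ (Ideal.span {X}).minimalPrimes ∧ q ≤ M}, (q.comap (algebraMap R T) : Ideal R) := by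
      intro y hy
      obtain ⟨q, hq, hqM, hyq⟩ := hcon y hy
      exact Set.mem_biUnion (⟨hq, hqM⟩ : q ∈ {q | _ ∧ _}) hyq
    rw [Ideal.subset_union_prime_finite hfin ⊥ ⊥ (fun q hq _ _ => by
      have := hq.1.isPrime
      exact Ideal.comap_isPrime _ _)] at hsub
    obtain ⟨q, ⟨hq, hqM⟩, hle⟩ := hsub
    have := hq.isPrime
    rcases hqM.lt_or_eq with h | rfl
    · exact absurd hle (not_le_of_gt (Ideal.IsIntegral.comap_lt_comap h))
    · have := hq.2 ⟨inferInstance, by rwa [Ideal.span_le, Set.singleton_subset_iff]⟩ hlt.le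
      exact absurd this (not_le_of_gt hlt)
  obtain ⟨y, hyM, hy⟩ := hex
  refine ⟨y, hyM, fun k l t b h => ?_⟩
  by_contra! hcon
  let J : Ideal T := (Ideal.span {X ^ k}).colon {t}
  have hJ : ∀ a, a ∈ J ↔ X ^ k ∣ a * t := by
    intro a
    rw [Submodule.mem_colon_singleton, smul_eq_mul, Ideal.mem_span_singleton]
  have hJM : J ≤ M := by
    intro a ha
    by_contra hn
    obtain ⟨b', hb'⟩ := (hJ a).1 ha
    exact hcon a hn b' hb'
  obtain ⟨Q, hQ, hQM⟩ := Ideal.exists_minimalPrimes_le hJM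
  have hQp := hQ.isPrime
  have hass : Q ∈ associatedPrimes T (T ⧸ J) := by
    apply Module.associatedPrimes.minimalPrimes_annihilator_subset_associatedPrimes T (T ⧸ J)
    rwa [Ideal.annihilator_quotient]
  obtain ⟨u', hu'⟩ := ((isAssociatedPrime_iff.1 hass)).2
  obtain ⟨u, rfl⟩ := Ideal.Quotient.mk_surjective u'
  have hQu : ∀ a, a ∈ Q ↔ X ^ k ∣ a * (u * t) := by
    intro a
    rw [hu', Submodule.mem_colon_singleton, Submodule.mem_bot]
    change Ideal.Quotient.mk J (a * u) = 0 ↔ _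
    rw [Ideal.Quotient.eq_zero_iff_mem, hJ, mul_assoc]
  have hht : Q.height ≤ 1 := height_le_one_of_assoc Q (X ^ k) (u * t) (pow_ne_zero _ hx0) hQu
  have hXQ : X ∈ Q := hQp.mem_of_pow_mem k ((hQu _).2 (Dvd.intro _ rfl))
  have hyQ : algebraMap R T y ∈ Q := hQp.mem_of_pow_mem l (hQ.le ((hJ _).2 ⟨b, h⟩))
  refine hy Q ?_ hQM hyQ
  refine ⟨⟨hQp, by rwa [Ideal.span_le, Set.singleton_subset_iff]⟩, ?_⟩
  rintro q ⟨hqp, hq⟩ hqQ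
  by_contra hnle
  have hXq : X ∈ q := hq (Ideal.subset_span rfl)
  have h1 : q.height < Q.height :=
    Ideal.height_strict_mono_of_isPrime_of_isPrime (lt_of_le_not_ge hqQ hnle)
  have hb : (⊥ : Ideal T) < q := bot_lt_iff_ne_bot.2 fun h0 => hx0 (by rwa [h0] at hXq)
  have h2 : (⊥ : Ideal T).height < q.height :=
    Ideal.height_strict_mono_of_isPrime_of_isPrime hb
  have h3 : 1 ≤ q.height := Order.one_le_iff_pos.2 (lt_of_le_of_lt bot_le h2)
  exact absurd (h3.trans_lt (h1.trans_le hht)) (lt_irrefl _)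

lemma mem_idealIC_of_scaleRoots {R : Type*} [CommRing R] (F : R[X]) (hF : F.Monic)
    (hn : 0 < F.natDegree) (b x : R) (h : eval b (scaleRoots F x) = 0) :
    b ∈ idealIC (Ideal.span {x}) := by
  refine ⟨F.natDegree, fun j => F.coeff (F.natDegree - j) * x ^ j, hn, ?_, ?_⟩
  · intro j _ _
    exact Ideal.mul_mem_left _ _ (Ideal.pow_mem_pow (Ideal.mem_span_singleton_self x) j)
  · rw [eval_eq_sum_range, natDegree_scaleRoots, Finset.sum_range_succ] at h
    simp only [coeff_scaleRoots, Nat.sub_self, pow_zero, mul_one, hF.coeff_natDegree, one_mul] at h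
    rw [add_comm, ← h]
    congr 1
    refine Finset.sum_bij' (fun j _ => F.natDegree - j) (fun i _ => F.natDegree - i) ?_ ?_ ?_ ?_ ?_
    · intro j hj
      simp only [Finset.mem_Icc, Finset.mem_range] at *
      omega
    · intro j hj
      simp only [Finset.mem_Icc, Finset.mem_range] at *
      omega
    · intro j hj
      simp only [Finset.mem_Icc] at *
      omega
    · intro j hj
      simp only [Finset.mem_range] at *
      omega
    · intro j hj
      simp only [Finset.mem_Icc] at hj
      have : F.natDegree - (F.natDegree - j) = j := by omega
      rw [this]

lemma mul_integral_mem {R : Type*} [CommRing R] (p : Ideal R) [p.IsPrime] (c : R)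
    (hc : ∀ I : Ideal R, ∀ r ∈ idealIC I, c * r ∈ I) (u : Localization.AtPrime p)
    (hu : IsIntegral R u) : ∃ w : R, algebraMap R (Localization.AtPrime p) c * u =
      algebraMap R (Localization.AtPrime p) w := by
  obtain ⟨F, hF, hFu⟩ := hu
  obtain ⟨b, s, rfl⟩ := IsLocalization.exists_mk'_eq p.primeCompl u
  have hn : 0 < F.natDegree := by
    rw [Nat.pos_iff_ne_zero]
    intro h0
    rw [hF.natDegree_eq_zero] at h0
    simp [h0] at hFu
  have h1 := scaleRoots_aeval_eq_zero_of_aeval_mk'_eq_zero (M := p.primeCompl) (p := F) (r := b)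
    (s := s) hFu
  rw [aeval_algebraMap_apply, IsLocalization.map_eq_zero_iff p.primeCompl] at h1
  obtain ⟨t, ht⟩ := h1
  have ht' : (t : R) * eval b (scaleRoots F (s : R)) = 0 := by
    simpa [coe_aeval_eq_eval] using ht
  have h2 : eval ((t : R) * b) (scaleRoots F (s * t)) = 0 := by
    rw [scaleRoots_mul, scaleRoots_eval_mul, natDegree_scaleRoots]
    obtain ⟨n, hn'⟩ := Nat.exists_eq_succ_of_ne_zero hn.ne'
    rw [hn', pow_succ, mul_assoc]
    rw [ht', mul_zero]
  have h3 := hc _ _ (mem_idealIC_of_scaleRoots F hF hn _ _ h2)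
  rw [Ideal.mem_span_singleton] at h3
  obtain ⟨w, hw⟩ := h3
  refine ⟨w, ?_⟩
  rw [IsLocalization.mul_mk'_eq_mk'_of_mul, IsLocalization.mk'_eq_iff_eq_mul, ← map_mul]
  rw [IsLocalization.eq_iff_exists p.primeCompl]
  exact ⟨t, by linear_combination hw⟩

lemma pow_mul_pow_mem_idealIC {R : Type*} [CommRing R] (x y : R) (i : ℕ) (hi : 0 < i) :
    x ^ i * y ^ i ∈ idealIC (Ideal.span {x ^ (2 * i), y ^ (2 * i)}) := by
  refine ⟨2, fun j => if j = 2 then -(x ^ i * y ^ i) ^ 2 else 0, by norm_num, ?_, ?_⟩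
  · intro j _ _
    dsimp only
    split_ifs with h
    · subst h
      have : -(x ^ i * y ^ i) ^ 2 = -(x ^ (2 * i) * y ^ (2 * i)) := by ring
      rw [this, pow_two]
      exact neg_mem (Ideal.mul_mem_mul (Ideal.subset_span (by simp)) (Ideal.subset_span (by simp)))
    · exact zero_mem _
  · rw [show Finset.Icc 1 2 = {1, 2} by rfl, Finset.sum_pair (by norm_num)]
    simp

/-- `Ī / I` is contained in `lic(0, R/I)`. -/
lemma mk_mem_lic {R : Type*} [CommRing R] (I : Ideal R) (r : R) (hr : r ∈ idealIC I) :
    Ideal.Quotient.mk I r ∈ lic (⊥ : Submodule R (R ⧸ I)) := by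
  obtain ⟨n, a, hn, ha, h⟩ := hr
  refine ⟨Finsupp.single 1 r, ?_, ?_⟩
  swap
  · rw [Finsupp.linearCombination_single]
    change Ideal.Quotient.mk I (r * 1) = _
    rw [mul_one]
  let K : Submodule R ((R ⧸ I) →₀ R) :=
    Submodule.comap (Finsupp.linearCombination R (id : R ⧸ I → R ⧸ I)) ⊥
  let B := Algebra.adjoin R (symEmb R (R ⧸ I) '' K)
  change IsIntegral B (symEmb R (R ⧸ I) (Finsupp.single 1 r))
  let X : MvPolynomial (R ⧸ I) R := MvPolynomial.X 1
  have hsym : ∀ s : R, symEmb R (R ⧸ I) (Finsupp.single 1 s) = MvPolynomial.C s * X := by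
    intro s
    rw [symEmb, Finsupp.linearCombination_single, MvPolynomial.smul_eq_C_mul]
  have hmem1 : ∀ s ∈ I, MvPolynomial.C s * X ∈ B := by
    intro s hs
    rw [← hsym]
    refine Algebra.subset_adjoin ⟨_, ?_, rfl⟩
    change Finsupp.linearCombination R id _ ∈ (⊥ : Submodule R (R ⧸ I))
    rw [Finsupp.linearCombination_single, Submodule.mem_bot]
    change Ideal.Quotient.mk I (s * 1) = 0
    rwa [mul_one, Ideal.Quotient.eq_zero_iff_mem]
  have hmem : ∀ (j : ℕ), ∀ s ∈ I ^ j, MvPolynomial.C s * X ^ j ∈ B := by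
    intro j
    induction j with
    | zero =>
      intro s _
      rw [pow_zero, mul_one]
      exact B.algebraMap_mem s
    | succ j ih =>
      intro s hs
      rw [pow_succ] at hs
      induction hs using Submodule.mul_induction_on' with
      | mem_mul_mem s hs t ht =>
        have := B.mul_mem (ih s hs) (hmem1 t ht)
        rw [map_mul, pow_succ]
        convert this using 1
        ring
      | add s _ t _ h1 h2 =>
        rw [map_add, add_mul]
        exact add_mem h1 h2
  choose! α hα using fun j (hj : 1 ≤ j ∧ j ≤ n) => (⟨⟨_, hmem j _ (ha j hj.1 hj.2)⟩, rfl⟩ :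
    ∃ b : B, (b : MvPolynomial (R ⧸ I) R) = MvPolynomial.C (a j) * X ^ j)
  refine ⟨Polynomial.X ^ n + ∑ j ∈ Finset.Icc 1 n, Polynomial.C (α j) * Polynomial.X ^ (n - j), ?_, ?_⟩
  · apply Polynomial.monic_X_pow_add
    refine (Polynomial.degree_sum_le _ _).trans_lt ?_
    rw [Finset.sup_lt_iff (by exact_mod_cast WithBot.bot_lt_coe n)]
    intro j hj
    rw [Finset.mem_Icc] at hj
    refine (Polynomial.degree_C_mul_X_pow_le _ _).trans_lt ?_
    exact_mod_cast (by omega : n - j < n)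
  · rw [hsym, Polynomial.eval₂_add, Polynomial.eval₂_finset_sum, Polynomial.eval₂_pow,
      Polynomial.eval₂_X]
    have h' := congrArg (fun z => MvPolynomial.C (σ := R ⧸ I) z * X ^ n) h
    simp only [map_add, map_sum, map_mul, map_pow, map_zero, zero_mul, add_mul,
      Finset.sum_mul] at h'
    rw [← h', mul_pow]
    congr 1
    refine Finset.sum_congr rfl fun j hj => ?_
    rw [Finset.mem_Icc] at hj
    rw [Polynomial.eval₂_mul, Polynomial.eval₂_C, Polynomial.eval₂_pow, Polynomial.eval₂_X]
    change (α j : MvPolynomial (R ⧸ I) R) * _ = _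
    rw [hα j hj, mul_pow]
    have : X ^ n = X ^ j * X ^ (n - j) := by rw [← pow_add]; congr 1; omega
    rw [this]
    ring

end LIC

namespace LIC

lemma main_aux {R A T : Type*} [CommRing R] [CommRing A] [CommRing T] [IsDomain T]
    [IsNoetherianRing A] [IsNoetherianRing T] [IsIntegrallyClosed T] [Algebra R A] [Algebra R T]
    [Algebra.IsIntegral R T] (g : A →ₐ[R] T) (hg : Function.Surjective g)
    (hnil : ∀ a, g a = 0 → IsNilpotent a) (q m : Ideal R) [q.IsPrime] [m.IsPrime]
    (hpq : RingHom.ker (algebraMap R T) < q) (hqm : q < m) (c : R)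
    (hc : ∀ I : Ideal R, ∀ r ∈ idealIC I, c * r ∈ I) :
    ∃ e, g e ≠ 0 ∧ e * algebraMap R A c = 0 := by
  obtain ⟨Q₀, -, hQ₀p, hQ₀⟩ := Ideal.exists_ideal_over_prime_of_isIntegral q (⊥ : Ideal T) hpq.le
  obtain ⟨M, hle, hMp, hM⟩ := Ideal.exists_ideal_over_prime_of_isIntegral m Q₀
    (hQ₀.le.trans hqm.le)
  have hlt : Q₀ < M := by
    refine lt_of_le_of_ne hle ?_
    rintro rfl
    exact hqm.ne (hQ₀.symm.trans hM)
  obtain ⟨x, hxq, hxp⟩ := Set.exists_of_ssubset hpq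
  have hx0 : algebraMap R T x ≠ 0 := fun h => hxp h
  have hxQ : algebraMap R T x ∈ Q₀ := by
    rw [← Ideal.mem_comap, hQ₀]; exact hxq
  obtain ⟨y, hyM, hy⟩ := core_normal M Q₀ hlt x hxQ hx0
  have hn : (RingHom.ker g).IsPrime := RingHom.ker_isPrime g
  have hMA : (M.comap g).IsPrime := Ideal.comap_isPrime g M
  have key := core_krull (RingHom.ker g) (M.comap g) (fun a ha => by
      rw [Ideal.mem_comap, (RingHom.mem_ker).1 ha]; exact M.zero_mem) (by
      intro q' hq' hle'
      refine le_antisymm hle' fun a ha => ?_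
      obtain ⟨k, hk⟩ := hnil a ha
      exact hq'.mem_of_pow_mem k (hk ▸ q'.zero_mem))
    (algebraMap R A x) (algebraMap R A y) (by
      rw [RingHom.mem_ker]; simpa using hx0) (by
      rw [Ideal.mem_comap]; simpa using hle hxQ) (by
      rw [Ideal.mem_comap]; simpa using hyM) (by
      intro k l a b hab
      rw [RingHom.mem_ker] at hab
      simp only [map_sub, map_mul, map_pow, AlgHom.commutes, sub_eq_zero] at hab
      obtain ⟨s, hs, b', hb'⟩ := hy k l _ _ hab
      obtain ⟨s, rfl⟩ := hg s
      obtain ⟨b', rfl⟩ := hg b'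
      refine ⟨s, hs, b', ?_⟩
      rw [RingHom.mem_ker]
      simp only [map_sub, map_mul, map_pow, AlgHom.commutes, sub_eq_zero]
      exact hb')
    (algebraMap R A c) (by
      intro i hi
      obtain ⟨α, β, h⟩ := Ideal.mem_span_pair.1 (hc _ _ (pow_mul_pow_mem_idealIC x y i hi))
      refine ⟨algebraMap R A α, algebraMap R A β, ?_⟩
      simp only [← map_pow, ← map_mul, ← map_add]
      rw [h])
  obtain ⟨e, he, h⟩ := key
  exact ⟨e, he, h⟩

lemma isNilpotent_of_residue_eq_zero {R : Type*} [CommRing R] (p : Ideal R) [p.IsPrime]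
    (hp : p ∈ minimalPrimes R) (a : Localization.AtPrime p)
    (ha : algebraMap (Localization.AtPrime p) p.ResidueField a = 0) : IsNilpotent a := by
  have h1 : a ∈ IsLocalRing.maximalIdeal (Localization.AtPrime p) := by
    rwa [← IsLocalRing.residue_eq_zero_iff]
  rw [← Localization.AtPrime.map_eq_maximalIdeal,
    ← IsLocalization.AtPrime.radical_map_of_mem_minimalPrimes (Localization.AtPrime p) p ⊥ hp,
    Ideal.map_bot] at h1
  exact h1

lemma isIntegral_lift {R Q κ : Type*} [CommRing R] [CommRing Q] [CommRing κ] [Algebra R Q]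
    [Algebra R κ] (g : Q →ₐ[R] κ) (hnil : ∀ a, g a = 0 → IsNilpotent a) (a : Q)
    (ha : IsIntegral R (g a)) : IsIntegral R a := by
  obtain ⟨F, hF, h⟩ := ha
  rw [← aeval_def, aeval_algHom_apply] at h
  obtain ⟨k, hk⟩ := hnil _ h
  refine ⟨F ^ k, hF.pow k, ?_⟩
  rw [← aeval_def, map_pow, hk]

/-- `c * (integral closure)` is finitely generated. -/
lemma exists_finite_set {R Q : Type*} [CommRing R] [IsNoetherianRing R] [CommRing Q] [Algebra R Q]
    (c : R) (h : ∀ u : Q, IsIntegral R u → ∃ w : R, algebraMap R Q c * u = algebraMap R Q w) :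
    ∃ t : Set Q, t.Finite ∧ (∀ u ∈ t, IsIntegral R u) ∧ ∀ u : Q, IsIntegral R u →
      ∃ a ∈ Submodule.span R t, algebraMap R Q c * u = algebraMap R Q c * a := by
  let N : Submodule R Q := Subalgebra.toSubmodule (integralClosure R Q)
  let f : Q →ₗ[R] Q := LinearMap.mulLeft R (algebraMap R Q c)
  have hle : N.map f ≤ LinearMap.range (Algebra.linearMap R Q) := by
    rintro _ ⟨u, hu, rfl⟩
    obtain ⟨w, hw⟩ := h u hu
    exact ⟨w, hw.symm⟩
  have hno : IsNoetherian R (LinearMap.range (Algebra.linearMap R Q)) := inferInstance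
  have hfg : (N.map f).FG := by
    have h1 := IsNoetherian.noetherian (Submodule.comap
      (LinearMap.range (Algebra.linearMap R Q)).subtype (N.map f))
    have h2 := h1.map (LinearMap.range (Algebra.linearMap R Q)).subtype
    rwa [Submodule.map_comap_subtype, inf_eq_right.2 hle] at h2
  obtain ⟨s, hs⟩ := hfg
  have hs' : ∀ v ∈ s, ∃ u ∈ N, f u = v := fun v hv => by
    have : v ∈ N.map f := hs ▸ Submodule.subset_span hv
    exact this
  choose! G hGN hG using hs'
  refine ⟨G '' s, s.finite_toSet.image G, ?_, ?_⟩
  · rintro _ ⟨v, hv, rfl⟩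
    exact hGN v hv
  · intro u hu
    have hu' : f u ∈ N.map f := ⟨u, hu, rfl⟩
    have hmap : (Submodule.span R (G '' s)).map f = N.map f := by
      rw [Submodule.map_span, ← hs, ← Set.image_comp]
      congr 1
      ext v
      constructor
      · rintro ⟨w, hw, rfl⟩
        rw [Function.comp_apply, hG w hw]; exact hw
      · intro hv
        exact ⟨v, hv, hG v hv⟩
    rw [← hmap] at hu'
    obtain ⟨a, ha, hfa⟩ := hu'
    exact ⟨a, ha, hfa.symm⟩

lemma main_prime {R : Type*} [CommRing R] [IsNoetherianRing R] (p q m : Ideal R) [p.IsPrime]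
    [q.IsPrime] [m.IsPrime] (hp : p ∈ minimalPrimes R) (hpq : p < q) (hqm : q < m) (c : R)
    (hcp : ∀ a, a ∈ p ↔ a * c = 0) (hc : ∀ I : Ideal R, ∀ r ∈ idealIC I, c * r ∈ I) : False := by
  let Q := Localization.AtPrime p
  let κ := p.ResidueField
  let T := integralClosure (R ⧸ p) κ
  let π : Q →ₐ[R] κ := IsScalarTower.toAlgHom R Q κ
  have hπs : Function.Surjective π := IsLocalRing.residue_surjective
  have hπ : ∀ a : Q, π a = 0 → IsNilpotent a := isNilpotent_of_residue_eq_zero p hp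
  have hunit : ∀ a : Q, π a ≠ 0 → IsUnit a := by
    intro a ha
    exact (IsLocalRing.residue_ne_zero_iff_isUnit a).1 ha
  have hcQ : algebraMap R Q c ≠ 0 := by
    intro h0
    rw [IsLocalization.map_eq_zero_iff p.primeCompl] at h0
    obtain ⟨s, hs⟩ := h0
    exact s.2 ((hcp _).2 hs)
  have : IsIntegrallyClosed T := integralClosure.isIntegrallyClosedOfFiniteExtension κ
  have hintRp : Algebra.IsIntegral R (R ⧸ p) := inferInstance
  have hTint : Algebra.IsIntegral R T := Algebra.IsIntegral.trans (R ⧸ p)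
  obtain ⟨t, htf, hti, ht⟩ := exists_finite_set (Q := Q) c (mul_integral_mem p c hc)
  let A := Algebra.adjoin R t
  have hAfin : Module.Finite R A := by
    have := fg_adjoin_of_finite htf hti
    exact Module.Finite.iff_fg.2 this
  have hAno : IsNoetherianRing A := IsNoetherianRing.of_finite R A
  have hmemT : ∀ a : A, π a ∈ T.restrictScalars R := by
    intro a
    have h1 : IsIntegral R a := Algebra.IsIntegral.isIntegral a
    have h2 : IsIntegral R (π a) := (h1.map A.val).map π
    exact h2.tower_top
  let g : A →ₐ[R] T := (π.comp A.val).codRestrict (T.restrictScalars R) hmemT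
  have hgv : ∀ a : A, ((g a : T) : κ) = π a := fun a => rfl
  have hg0 : ∀ a : A, g a = 0 ↔ π a = 0 := by
    intro a
    rw [← hgv, ← Subtype.coe_inj]
    rfl
  have hgs : Function.Surjective g := by
    intro u
    obtain ⟨v, hv⟩ := hπs (u : κ)
    have hu : IsIntegral R (u : κ) :=
      (Algebra.IsIntegral.isIntegral (R := R) u).map (IsScalarTower.toAlgHom R T κ)
    have hvi : IsIntegral R v := isIntegral_lift π hπ v (by rw [hv]; exact hu)
    obtain ⟨a, ha, h⟩ := ht v hvi
    have haA : a ∈ A := Algebra.span_le_adjoin R t ha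
    refine ⟨⟨a, haA⟩, Subtype.ext ?_⟩
    rw [hgv, ← hv]
    by_contra hne
    have hne' : π (v - a) ≠ 0 := by
      rw [map_sub, sub_ne_zero]
      exact fun h => hne h.symm
    have h0 : algebraMap R Q c * (v - a) = 0 := by rw [mul_sub, h, sub_self]
    exact hcQ ((hunit _ hne').mul_left_eq_zero.1 h0)
  have hTno : IsNoetherianRing T := isNoetherianRing_of_surjective A T g.toRingHom hgs
  have hnil : ∀ a, g a = 0 → IsNilpotent a := by
    intro a ha
    obtain ⟨k, hk⟩ := hπ _ ((hg0 a).1 ha)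
    exact ⟨k, Subtype.ext hk⟩
  have hker : RingHom.ker (algebraMap R T) = p := by
    ext r
    rw [RingHom.mem_ker]
    have : algebraMap R κ r = 0 ↔ r ∈ p := Ideal.algebraMap_residueField_eq_zero
    rw [← this, ← Subtype.coe_inj]
    rfl
  obtain ⟨e, he, hec⟩ := main_aux g hgs hnil q m (by rw [hker]; exact hpq) hqm c hc
  have hu := hunit e fun h => he ((hg0 e).2 h)
  have hec' : (e : Q) * algebraMap R Q c = 0 := congrArg Subtype.val hec
  exact hcQ (hu.mul_right_eq_zero.1 hec')

lemma main_lemma {R : Type*} [CommRing R] [IsLocalRing R] [IsNoetherianRing R]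
    (hdim : 2 ≤ ringKrullDim R) (hequi : IsEquidimensionalRing R) (hemb : HasNoEmbeddedPrimes R)
    (c : R) (hc : ∀ I : Ideal R, ∀ r ∈ idealIC I, c * r ∈ I) : c = 0 := by
  by_contra hc0
  obtain ⟨p, hpa, -⟩ := exists_le_isAssociatedPrime_of_isNoetherianRing R
    (⟨c, Ideal.mem_span_singleton_self c⟩ : Ideal.span {c}) (fun h => hc0 (congrArg Subtype.val h))
  obtain ⟨hpp, ⟨d, hd⟩, hpd⟩ := isAssociatedPrime_iff.1 hpa
  have hcp : ∀ a, a ∈ p ↔ a * d = 0 := by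
    intro a
    rw [hpd, Submodule.mem_colon_singleton, Submodule.mem_bot, ← Subtype.coe_inj]
    rfl
  have hdc : ∀ I : Ideal R, ∀ r ∈ idealIC I, d * r ∈ I := by
    obtain ⟨w, rfl⟩ := Ideal.mem_span_singleton.1 hd
    intro I r hr
    have := I.mul_mem_left w (hc I r hr)
    convert this using 1
    ring
  have hpmin : p ∈ minimalPrimes R := by
    refine hemb p (isAssociatedPrime_iff.2 ⟨hpp, d, ?_⟩)
    ext a
    rw [hcp, Submodule.mem_colon_singleton, Submodule.mem_bot]
    rfl
  have hdimp : 2 ≤ ringKrullDim (R ⧸ p) := (hequi p hpmin) ▸ hdim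
  obtain ⟨l, hl⟩ := Order.le_krullDim_iff.1 (show ((2 : ℕ) : WithBot ℕ∞) ≤ _ from hdimp)
  have h01 : l ⟨0, by omega⟩ < l ⟨1, by omega⟩ := l.strictMono (by simp [Fin.lt_def])
  have h12 : l ⟨1, by omega⟩ < l ⟨2, by omega⟩ := l.strictMono (by simp [Fin.lt_def])
  let φ := Ideal.Quotient.mk p
  have hφ : Function.Surjective φ := Ideal.Quotient.mk_surjective
  have hlt : ∀ P P' : PrimeSpectrum (R ⧸ p), P < P' → P.asIdeal.comap φ < P'.asIdeal.comap φ := by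
    intro P P' h
    refine lt_of_le_not_ge (Ideal.comap_mono (le_of_lt h)) fun h' => ?_
    exact not_le_of_gt h ((Ideal.comap_le_comap_iff_of_surjective φ hφ _ _).1 h')
  have hq : ((l ⟨1, by omega⟩).asIdeal.comap φ).IsPrime := Ideal.comap_isPrime _ _
  have h2 : ((l ⟨2, by omega⟩).asIdeal.comap φ).IsPrime := Ideal.comap_isPrime _ _
  refine main_prime p _ _ hpmin (lt_of_le_of_lt ?_ (hlt _ _ h01)) (hlt _ _ h12) d hcp hdc
  intro a ha
  rw [Ideal.mem_comap, Ideal.Quotient.eq_zero_iff_mem.2 ha]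
  exact zero_mem _

end LIC

end

universe u

/-- Let `(R,m)` be a Noetherian local ring that is either excellent or
a homomorphic image of a Gorenstein local ring, with `dim R ≥ 2`, equidimensional and
with no embedded primes.  Then `τ_M = τ_I = 0`: the intersection over all finitely
generated modules `M` of `ann lic(0,M)` is zero, and the intersection over all ideals
`I` of `(I :_R Ī)` is zero. -/
theorem tau_eq_bot_of_two_le_dim {R : Type u} [CommRing R] [IsLocalRing R]
    [IsNoetherianRing R]
    (hexc : LIC.IsExcellentRing.{u} R ∨
      ∃ (S : Type u) (_ : CommRing S), LIC.IsGorensteinLocalRing.{u} S ∧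
        ∃ f : S →+* R, Function.Surjective f)
    (hdim : 2 ≤ ringKrullDim R)
    (hequi : LIC.IsEquidimensionalRing R)
    (hemb : LIC.HasNoEmbeddedPrimes R) :
    sInf {J : Ideal R | ∃ (M : Type u) (_ : AddCommGroup M) (_ : Module R M),
        Module.Finite R M ∧ J = (LIC.lic (⊥ : Submodule R M)).annihilator} = ⊥ ∧
    (⨅ I : Ideal R, LIC.colonIdeal I (LIC.idealIC I)) = ⊥ := by
  have key : ∀ c : R, (∀ I : Ideal R, ∀ r ∈ LIC.idealIC I, c * r ∈ I) → c = 0 :=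
    LIC.main_lemma hdim hequi hemb
  constructor
  · rw [eq_bot_iff]
    intro c hc
    refine key c fun I r hr => ?_
    rw [Submodule.mem_sInf] at hc
    have h1 := hc _ ⟨R ⧸ I, inferInstance, inferInstance, inferInstance, rfl⟩
    have h2 := Submodule.mem_annihilator.1 h1 _ (LIC.mk_mem_lic I r hr)
    rw [← Ideal.Quotient.eq_zero_iff_mem]
    exact h2
  · rw [eq_bot_iff]
    intro c hc
    refine key c fun I r hr => ?_
    rw [Submodule.mem_iInf] at hc
    exact hc I r hr
end
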